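/- arXiv:1904.00656 — 13 statements merged into one kernel-verified Lean document; each statement's English description precedes it below -/
import Mathlib

section
/- Let L be a relational first-order language and let 𝕏 be a countably infinite ultrahomogeneous L-structure with universe X. For any subset A ⊆ X, the following are equivalent: (1) A is a copy of 𝕏 (i.e., the induced substructure on A is isomorphic to 𝕏); (2) for every finite set F ⊆ A and every x ∈ X∖F, the orbit orb_F(x) intersects A. -/
open FirstOrder FirstOrder.Language Set

universe u v w

/-- For a relational language, any subset of a structure carries an induced substructure. -/
def inducedSub (L : Language.{u}) [L.IsRelational] {M : Type w} [L.Structure M]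
    (A : Set M) : L.Substructure M where
  carrier := A
  fun_mem := fun {n} f => isEmptyElim f

/-- `A` is a copy of `M`: the induced substructure on `A` is isomorphic to `M`. -/
def IsCopy (L : Language.{u}) [L.IsRelational] {M : Type w} [L.Structure M]
    (A : Set M) : Prop :=
  Nonempty ((inducedSub L A) ≃[L] M)

/-- The orbit of `x` under automorphisms of `M` fixing `F` pointwise. -/
def orb (L : Language.{u}) {M : Type w} [L.Structure M] (F : Set M) (x : M) : Set M :=
  {y | ∃ g : M ≃[L] M, (∀ a ∈ F, g a = a) ∧ g x = y}

theorem copies_are_orbit_hitting_sets (L : Language.{u}) [L.IsRelational]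
    (M : Type w) [L.Structure M] [Countable M] [Infinite M]
    (hM : L.IsUltrahomogeneous M) (A : Set M) :
    IsCopy L A ↔
      ∀ F : Set M, F.Finite → F ⊆ A → ∀ x ∈ (Set.univ : Set M) \ F,
        (orb L F x ∩ A).Nonempty := by
  constructor
  · rintro ⟨e⟩ F hF hFA x -
    let φ : M ↪[L] M := (inducedSub L A).subtype.comp e.symm.toEmbedding
    have hφA : ∀ z, φ z ∈ A := fun z => (e.symm z).2
    have ext : ∀ S : Set M, S.Finite → ∃ g : M ≃[L] M, ∀ s ∈ S, g s = φ s := by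
      intro S hS
      obtain ⟨g, hg⟩ := hM (Substructure.closure L S) (Substructure.fg_closure hS)
        (φ.comp (Substructure.closure L S).subtype)
      refine ⟨g, fun s hs => ?_⟩
      have := DFunLike.congr_fun hg ⟨s, Substructure.subset_closure hs⟩
      exact this.symm
    have hfin : (φ ⁻¹' F).Finite := hF.preimage φ.injective.injOn
    have hpre : ∀ a ∈ F, ∃ b, φ b = a := by
      intro a ha
      refine ⟨e ⟨a, hFA ha⟩, ?_⟩
      change ((e.symm (e ⟨a, hFA ha⟩) : inducedSub L A) : M) = a
      exact congrArg Subtype.val (FirstOrder.Language.Equiv.symm_apply_apply e _)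
    obtain ⟨g, hg⟩ := ext _ hfin
    obtain ⟨k, hk⟩ := ext _ (hfin.insert (g.symm x))
    refine ⟨φ (g.symm x), ⟨k.comp g.symm, ?_, ?_⟩, hφA _⟩
    · intro a ha
      obtain ⟨b, rfl⟩ := hpre a ha
      have h1 : g b = φ b := hg b ha
      have h2 : k b = φ b := hk b (Set.mem_insert_of_mem _ ha)
      rw [Equiv.comp_apply, ← h1, FirstOrder.Language.Equiv.symm_apply_apply, h2, h1]
    · rw [Equiv.comp_apply]
      exact hk _ (Set.mem_insert _ _)
  · intro H
    have hAM : L.IsExtensionPair (inducedSub L A) M := by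
      rw [isExtensionPair_iff_exists_embedding_closure_singleton_sup]
      intro S hS f m
      exact hM.extend_embedding (S.fg_iff_structure_fg.1 hS)
        (h := ⟨(inducedSub L A).subtype.comp (Substructure.subtype _)⟩) f _
    have hMA : L.IsExtensionPair M (inducedSub L A) := by
      rw [isExtensionPair_iff_exists_embedding_closure_singleton_sup]
      intro S hS f m
      obtain ⟨g, hg⟩ := hM S hS ((inducedSub L A).subtype.comp f)
      have hg' : ∀ s : S, ((f s : inducedSub L A) : M) = g s := fun s =>
        DFunLike.congr_fun hg s
      have : Finite S := hS.finite
      obtain ⟨h, hfix, hmem⟩ : ∃ h : M ≃[L] M,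
          (∀ a ∈ Set.range (fun s : S => g s), h a = a) ∧ h (g m) ∈ A := by
        have hsub : Set.range (fun s : S => g s) ⊆ A := by
          rintro _ ⟨s, rfl⟩
          change g s ∈ A
          rw [← hg' s]
          exact (f s).2
        by_cases hx : g m ∈ Set.range (fun s : S => g s)
        · exact ⟨FirstOrder.Language.Equiv.refl L M, fun _ _ => rfl, hsub hx⟩
        · obtain ⟨y, ⟨h, h1, h2⟩, hy⟩ := H _ (Set.finite_range _) hsub (g m) ⟨trivial, hx⟩
          exact ⟨h, h1, h2 ▸ hy⟩
      have hle : Substructure.closure L {m} ⊔ S ≤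
          (inducedSub L A).comap (h.comp g).toHom := by
        refine sup_le ?_ ?_
        · rw [Substructure.closure_le]
          rintro _ rfl
          exact hmem
        · intro s hs
          change h (g s) ∈ A
          have h3 : h (g s) = g s := hfix _ ⟨⟨s, hs⟩, rfl⟩
          have h4 : (f ⟨s, hs⟩ : M) = g s := hg' ⟨s, hs⟩
          rw [h3, ← h4]
          exact (f _).2
      refine ⟨Embedding.codRestrict (inducedSub L A)
        ((h.comp g).toEmbedding.comp (Substructure.subtype _)) (fun c => hle c.2), ?_⟩
      ext s
      change ((f s : inducedSub L A) : M) = h (g s)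
      rw [hfix _ ⟨s, rfl⟩, hg' s]
    let f₀ : (⊥ : L.Substructure (inducedSub L A)) ↪[L] M :=
      (inducedSub L A).subtype.comp (Substructure.subtype _)
    have : Countable (inducedSub L A) := Subtype.countable
    obtain ⟨e, -⟩ := equiv_between_cg Structure.cg_of_countable Structure.cg_of_countable
      ⟨⟨⊥, _, f₀.equivRange⟩, Substructure.fg_bot⟩ hAM hMA
    exact ⟨e⟩
end

section
/- If {D_n : n ∈ ℕ} is a partition of ℕ into infinitely many infinite sets, then there exists a family {A_α : α < 2^ℵ₀} of infinite subsets of ℕ, of cardinality continuum, such that A_α ∩ A_β is finite for all α ≠ β, and A_α ∩ D_n is infinite for every α < 2^ℵ₀ and every n ∈ ℕ. -/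
theorem ad_refinement_of_partition (D : ℕ → Set ℕ)
    (hinf : ∀ n, (D n).Infinite)
    (hdisj : ∀ m n, m ≠ n → Disjoint (D m) (D n))
    (hcover : (⋃ n, D n) = Set.univ) :
    ∃ 𝒜 : Set (Set ℕ), Cardinal.mk 𝒜 = Cardinal.continuum ∧
      (∀ A ∈ 𝒜, A.Infinite) ∧
      (∀ A ∈ 𝒜, ∀ B ∈ 𝒜, A ≠ B → (A ∩ B).Finite) ∧
      (∀ A ∈ 𝒜, ∀ n, (A ∩ D n).Infinite) := by
  classical
  let e : ∀ n, ℕ ↪ D n := fun n => (hinf n).natEmbedding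
  let c : (ℕ → Bool) → ℕ → ℕ := fun f k => Encodable.encode ((List.range k).map f)
  have hc : ∀ f g k l, c f k = c g l → k = l ∧ ∀ i < k, f i = g i := by
    intro f g k l h
    have h1 := Encodable.encode_injective h
    have h2 : k = l := by simpa using congrArg List.length h1
    subst h2
    refine ⟨rfl, fun i hi => ?_⟩
    exact (List.map_inj_left.1 h1) i (List.mem_range.2 hi)
  let A : (ℕ → Bool) → Set ℕ := fun f => {x | ∃ n k, n ≤ k ∧ x = (e n (c f k) : ℕ)}
  have hAD : ∀ f n, (A f ∩ D n).Infinite := by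
    intro f n
    have hinj : Function.Injective (fun k : ℕ => (e n (c f (n + k)) : ℕ)) := by
      intro k l h
      have := (hc f f _ _ ((e n).injective (Subtype.ext h))).1
      omega
    refine (Set.infinite_range_of_injective hinj).mono ?_
    rintro _ ⟨k, rfl⟩
    exact ⟨⟨n, n + k, by omega, rfl⟩, (e n _).2⟩
  have hA : ∀ f, (A f).Infinite := fun f => (hAD f 0).mono Set.inter_subset_left
  have hfin : ∀ f g, f ≠ g → (A f ∩ A g).Finite := by
    intro f g hfg
    obtain ⟨d, hd⟩ := Function.ne_iff.1 hfg
    refine (((Set.finite_Iic d).prod (Set.finite_Iic d)).image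
      (fun p : ℕ × ℕ => (e p.1 (c f p.2) : ℕ))).subset ?_
    rintro x ⟨⟨n, k, hnk, rfl⟩, ⟨m, l, hml, h⟩⟩
    have hnm : n = m := by
      by_contra hne
      exact Set.disjoint_left.1 (hdisj n m hne) (e n _).2 (h ▸ (e m _).2)
    subst hnm
    obtain ⟨_, h2⟩ := hc f g _ _ ((e n).injective (Subtype.ext h))
    have hk : k ≤ d := by
      by_contra hk
      exact hd (h2 d (by omega))
    exact ⟨(n, k), ⟨le_trans hnk hk, hk⟩, rfl⟩
  have hAinj : Function.Injective A := by
    intro f g h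
    by_contra hne
    have := hfin f g hne
    rw [← h, Set.inter_self] at this
    exact hA f this
  refine ⟨Set.range A, ?_, ?_, ?_, ?_⟩
  · rw [Cardinal.mk_range_eq A hAinj]
    simp
  · rintro _ ⟨f, rfl⟩
    exact hA f
  · rintro _ ⟨f, rfl⟩ _ ⟨g, rfl⟩ h
    exact hfin f g (fun h' => h (h' ▸ rfl))
  · rintro _ ⟨f, rfl⟩ n
    exact hAD f n
end

section
/- For n ∈ ℤ, let I_n = {q ∈ ℚ : (2n−1)·√2 < q < (2n+1)·√2}. Then the family {I_n : n ∈ ℤ} is a countably infinite maximal antichain in ℙ(ℚ): the sets I_n are copies of ℚ, they are pairwise incompatible, and every copy of ℚ is compatible with some I_n. -/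
/-- `A ⊆ ℚ` is a copy of `ℚ` : `⟨A,<⟩` is order-isomorphic to `⟨ℚ,<⟩`. -/
def IsCopyQ (A : Set ℚ) : Prop := Nonempty (A ≃o ℚ)

/-- Two copies of `ℚ` are compatible if some copy is contained in both. -/
def CompatQ (A B : Set ℚ) : Prop := ∃ C : Set ℚ, IsCopyQ C ∧ C ⊆ A ∧ C ⊆ B

/-- The interval `((2n-1)√2, (2n+1)√2)` in `ℚ`. -/
noncomputable def I (n : ℤ) : Set ℚ :=
  {q : ℚ | (2 * (n : ℝ) - 1) * Real.sqrt 2 < (q : ℝ) ∧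
           (q : ℝ) < (2 * (n : ℝ) + 1) * Real.sqrt 2}

theorem copy_of (A : Set ℚ) (h0 : A.Nonempty) (h1 : ∀ x ∈ A, ∃ y ∈ A, x < y)
    (h2 : ∀ x ∈ A, ∃ y ∈ A, y < x) (h3 : ∀ x ∈ A, ∀ y ∈ A, x < y → ∃ z ∈ A, x < z ∧ z < y) :
    IsCopyQ A := by
  haveI : Nonempty A := h0.to_subtype
  haveI : NoMaxOrder A := ⟨fun x => by
    obtain ⟨y, hy, h⟩ := h1 x x.2
    exact ⟨⟨y, hy⟩, h⟩⟩
  haveI : NoMinOrder A := ⟨fun x => by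
    obtain ⟨y, hy, h⟩ := h2 x x.2
    exact ⟨⟨y, hy⟩, h⟩⟩
  haveI : DenselyOrdered A := ⟨fun x y hxy => by
    obtain ⟨z, hz, h⟩ := h3 x x.2 y y.2 hxy
    exact ⟨⟨z, hz⟩, h⟩⟩
  exact Order.iso_of_countable_dense A ℚ

theorem copy_I (n : ℤ) : IsCopyQ (I n) := by
  have hs : (0 : ℝ) < Real.sqrt 2 := by positivity
  apply copy_of
  · obtain ⟨q, h1, h2⟩ := exists_rat_btwn
      (show (2 * (n : ℝ) - 1) * Real.sqrt 2 < (2 * (n : ℝ) + 1) * Real.sqrt 2 by nlinarith)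
    exact ⟨q, h1, h2⟩
  · rintro x ⟨h1, h2⟩
    obtain ⟨q, h3, h4⟩ := exists_rat_btwn h2
    exact ⟨q, ⟨h1.trans h3, h4⟩, by exact_mod_cast h3⟩
  · rintro x ⟨h1, h2⟩
    obtain ⟨q, h3, h4⟩ := exists_rat_btwn h1
    exact ⟨q, ⟨h3, h4.trans h2⟩, by exact_mod_cast h4⟩
  · rintro x ⟨h1, h2⟩ y ⟨h3, h4⟩ hxy
    obtain ⟨z, h5, h6⟩ := exists_between hxy
    have h5' : (x : ℝ) < z := by exact_mod_cast h5
    have h6' : (z : ℝ) < y := by exact_mod_cast h6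
    exact ⟨z, ⟨h1.trans h5', h6'.trans h4⟩, h5, h6⟩

theorem I_disj {m n : ℤ} {q : ℚ} (h : q ∈ I m) (h' : q ∈ I n) : m = n := by
  have hs : (0 : ℝ) < Real.sqrt 2 := by positivity
  obtain ⟨a, b⟩ := h
  obtain ⟨c, d⟩ := h'
  have e := lt_of_mul_lt_mul_right (a.trans d) hs.le
  have f := lt_of_mul_lt_mul_right (c.trans b) hs.le
  have e' : 2 * m - 1 < 2 * n + 1 := by exact_mod_cast e
  have f' : 2 * n - 1 < 2 * m + 1 := by exact_mod_cast f
  omega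

theorem copy_nonempty {A : Set ℚ} (h : IsCopyQ A) : A.Nonempty := by
  obtain ⟨e⟩ := h
  exact ⟨e.symm 0, (e.symm 0).2⟩

noncomputable def idx (q : ℚ) : ℤ := ⌊((q : ℝ) / Real.sqrt 2 + 1) / 2⌋

theorem idx_mono : Monotone idx := by
  intro a b h
  have h' : (a : ℝ) ≤ b := by exact_mod_cast h
  unfold idx
  gcongr

theorem mem_I_idx (q : ℚ) : q ∈ I (idx q) := by
  have hs : (0 : ℝ) < Real.sqrt 2 := by positivity
  have h1 := Int.floor_le (((q : ℝ) / Real.sqrt 2 + 1) / 2)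
  have h2 := Int.lt_floor_add_one (((q : ℝ) / Real.sqrt 2 + 1) / 2)
  change ((idx q : ℤ) : ℝ) ≤ _ at h1
  change _ < ((idx q : ℤ) : ℝ) + 1 at h2
  have h3 : 2 * (idx q : ℝ) - 1 ≤ (q : ℝ) / Real.sqrt 2 := by linarith
  have h4 : (q : ℝ) / Real.sqrt 2 < 2 * (idx q : ℝ) + 1 := by linarith
  rw [le_div_iff₀ hs] at h3
  rw [div_lt_iff₀ hs] at h4
  refine ⟨lt_of_le_of_ne h3 ?_, h4⟩
  have hne : (2 * idx q - 1 : ℤ) ≠ 0 := by omega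
  have hi := irrational_sqrt_two.intCast_mul hne
  push_cast at hi
  exact hi.ne_rat q

theorem maximal (Z : Set ℚ) (hZ : IsCopyQ Z) : ∃ n : ℤ, CompatQ Z (I n) := by
  obtain ⟨e⟩ := hZ
  have key : ∃ a b : ℚ, a < b ∧ idx (e.symm a) = idx (e.symm b) := by
    by_contra! hcon
    have hm : StrictMono (fun a : ℚ => idx (e.symm a)) := fun a b hab =>
      lt_of_le_of_ne (idx_mono (by exact_mod_cast e.symm.monotone hab.le)) (hcon a b hab)
    have hinf : (Set.Icc (0 : ℚ) 1).Infinite := Set.Icc_infinite one_pos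
    refine hinf (Set.Finite.of_finite_image
      ((Set.finite_Icc (idx (e.symm 0)) (idx (e.symm 1))).subset ?_) (hm.injective.injOn))
    rintro _ ⟨x, ⟨h0, h1⟩, rfl⟩
    exact ⟨hm.monotone h0, hm.monotone h1⟩
  obtain ⟨a, b, hab, hi⟩ := key
  refine ⟨idx (e.symm a), (fun c : ℚ => (e.symm c : ℚ)) '' Set.Ioo a b, ?_, ?_, ?_⟩
  · have hlt : ∀ {c d : ℚ}, (e.symm c : ℚ) < e.symm d ↔ c < d := fun {c d} => by
      rw [Subtype.coe_lt_coe, e.symm.lt_iff_lt]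
    apply copy_of
    · exact (Set.nonempty_Ioo.2 hab).image _
    · rintro _ ⟨c, ⟨h1, h2⟩, rfl⟩
      obtain ⟨d, h3, h4⟩ := exists_between h2
      exact ⟨_, ⟨d, ⟨h1.trans h3, h4⟩, rfl⟩, hlt.2 h3⟩
    · rintro _ ⟨c, ⟨h1, h2⟩, rfl⟩
      obtain ⟨d, h3, h4⟩ := exists_between h1
      exact ⟨_, ⟨d, ⟨h3, h4.trans h2⟩, rfl⟩, hlt.2 h4⟩
    · rintro _ ⟨c, ⟨h1, h2⟩, rfl⟩ _ ⟨d, ⟨h3, h4⟩, rfl⟩ hcd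
      obtain ⟨z, h5, h6⟩ := exists_between (hlt.1 hcd)
      exact ⟨_, ⟨z, ⟨h1.trans h5, h6.trans h4⟩, rfl⟩, hlt.2 h5, hlt.2 h6⟩
  · rintro _ ⟨c, -, rfl⟩
    exact (e.symm c).2
  · rintro _ ⟨c, ⟨h1, h2⟩, rfl⟩
    have h3 : idx (e.symm a) ≤ idx (e.symm c) :=
      idx_mono (by exact_mod_cast e.symm.monotone h1.le)
    have h4 : idx (e.symm c) ≤ idx (e.symm b) :=
      idx_mono (by exact_mod_cast e.symm.monotone h2.le)
    have h5 : idx (e.symm c) = idx (e.symm a) := le_antisymm (hi ▸ h4) h3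
    rw [← h5]
    exact mem_I_idx _

theorem intervals_form_countable_max_antichain :
    (∀ n : ℤ, IsCopyQ (I n)) ∧
    Function.Injective I ∧
    (∀ m n : ℤ, m ≠ n → ¬ CompatQ (I m) (I n)) ∧
    (∀ Z : Set ℚ, IsCopyQ Z → ∃ n : ℤ, CompatQ Z (I n)) := by
  refine ⟨copy_I, ?_, ?_, maximal⟩
  · intro m n h
    obtain ⟨q, hq⟩ := copy_nonempty (copy_I m)
    exact I_disj hq (h ▸ hq)
  · rintro m n hmn ⟨C, hC, h1, h2⟩
    obtain ⟨q, hq⟩ := copy_nonempty hC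
    exact hmn (I_disj (h1 hq) (h2 hq))
end

section
/- The partial order ⟨ℙ(ℚ), ⊆⟩ contains a maximal antichain of cardinality 2^ℵ₀. -/
/-- A maximal antichain in the poset of copies of `ℚ`. -/
def IsMaxAntichainQ (𝒜 : Set (Set ℚ)) : Prop :=
  (∀ A ∈ 𝒜, IsCopyQ A) ∧
  (∀ A ∈ 𝒜, ∀ B ∈ 𝒜, A ≠ B → ¬ CompatQ A B) ∧
  (∀ Z : Set ℚ, IsCopyQ Z → ∃ A ∈ 𝒜, CompatQ Z A)

theorem copyQ_infinite {A : Set ℚ} (h : IsCopyQ A) : A.Infinite := by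
  obtain ⟨e⟩ := h
  have : Infinite A := Infinite.of_injective e.symm e.symm.injective
  exact Set.infinite_coe_iff.mp this

theorem compatQ_symm {A B : Set ℚ} (h : CompatQ A B) : CompatQ B A := by
  obtain ⟨C, h1, h2, h3⟩ := h
  exact ⟨C, h1, h3, h2⟩

theorem compatQ_self {A : Set ℚ} (h : IsCopyQ A) : CompatQ A A :=
  ⟨A, h, subset_rfl, subset_rfl⟩

/-- A family of copies indexed by sets of naturals, with pairwise finite intersections. -/
theorem exists_family : ∃ F : Set ℕ → Set ℚ, (∀ X, IsCopyQ (F X)) ∧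
    ∀ X Y, X ≠ Y → (F X ∩ F Y).Finite := by
  classical
  have : Countable (ℚ ×ₗ ℕ) := inferInstanceAs (Countable (ℚ × ℕ))
  obtain ⟨e⟩ := Order.embedding_from_countable_to_dense (ℚ ×ₗ ℕ) ℚ
  let g : Set ℕ → ℚ → ℕ := fun X q =>
    Encodable.encode ((Finset.range (Encodable.encode q)).filter (· ∈ X))
  let f : Set ℕ → ℚ → ℚ := fun X q => e (toLex (q, g X q))
  have hf : ∀ X, StrictMono (f X) := by
    intro X a b hab
    apply e.strictMono
    rw [Prod.Lex.toLex_lt_toLex]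
    exact Or.inl hab
  refine ⟨fun X => Set.range (f X), fun X => ⟨((hf X).orderIso).symm⟩, ?_⟩
  intro X Y hXY
  obtain ⟨k, hk⟩ : ∃ k, ¬ (k ∈ X ↔ k ∈ Y) := by
    by_contra! h
    exact hXY (Set.ext h)
  have hfin : {q : ℚ | Encodable.encode q ≤ k}.Finite :=
    (Set.finite_Iic k).preimage Encodable.encode_injective.injOn
  refine (hfin.image (f X)).subset ?_
  rintro _ ⟨⟨q, rfl⟩, ⟨q', hq⟩⟩
  refine ⟨q, ?_, rfl⟩
  have h1 := toLex.injective (e.injective hq)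
  rw [Prod.mk.injEq] at h1
  obtain ⟨rfl, h2⟩ := h1
  have h3 := Encodable.encode_injective h2
  by_contra hlt
  simp only [Set.mem_setOf_eq, not_le] at hlt
  have h4 := Finset.ext_iff.mp h3 k
  simp only [Finset.mem_filter, Finset.mem_range, hlt, true_and] at h4
  exact hk h4.symm

theorem max_antichain_of_copies_of_Q_of_size_continuum :
    ∃ 𝒜 : Set (Set ℚ), IsMaxAntichainQ 𝒜 ∧ Cardinal.mk 𝒜 = Cardinal.continuum := by
  obtain ⟨F, hF, hfin⟩ := exists_family
  have hinc : ∀ X Y, X ≠ Y → ¬ CompatQ (F X) (F Y) := by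
    rintro X Y hXY ⟨C, hC, h1, h2⟩
    exact copyQ_infinite hC ((hfin X Y hXY).subset (Set.subset_inter h1 h2))
  have hinj : Function.Injective F := by
    intro X Y h
    by_contra hne
    apply hinc X Y hne
    rw [← h]
    exact compatQ_self (hF X)
  let S : Set (Set (Set ℚ)) := {𝒜 | (∀ A ∈ 𝒜, IsCopyQ A) ∧
    (∀ A ∈ 𝒜, ∀ B ∈ 𝒜, A ≠ B → ¬ CompatQ A B)}
  have hS : Set.range F ∈ S := by
    constructor
    · rintro _ ⟨X, rfl⟩
      exact hF X
    · rintro _ ⟨X, rfl⟩ _ ⟨Y, rfl⟩ h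
      exact hinc X Y (fun h' => h (by rw [h']))
  obtain ⟨M, hFM, hM⟩ := zorn_subset_nonempty S (by
    intro c hc hchain _
    refine ⟨⋃₀ c, ⟨?_, ?_⟩, fun s hs => Set.subset_sUnion_of_mem hs⟩
    · rintro A ⟨s, hs, hA⟩
      exact (hc hs).1 A hA
    · rintro A ⟨s, hs, hA⟩ B ⟨t, ht, hB⟩
      rcases hchain.total hs ht with h | h
      · exact (hc ht).2 A (h hA) B hB
      · exact (hc hs).2 A hA B (h hB)) _ hS
  have hMS : M ∈ S := hM.prop
  refine ⟨M, ⟨hMS.1, hMS.2, ?_⟩, ?_⟩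
  · intro Z hZ
    by_contra! hno
    have hins : insert Z M ∈ S := by
      constructor
      · rintro A (rfl | hA)
        · exact hZ
        · exact hMS.1 A hA
      · rintro A (rfl | hA) B (rfl | hB) hne
        · exact absurd rfl hne
        · exact hno B hB
        · exact fun h => hno A hA (compatQ_symm h)
        · exact hMS.2 A hA B hB hne
    have hZM : Z ∈ M := hM.le_of_ge hins (Set.subset_insert Z M) (Set.mem_insert Z M)
    exact hno Z hZM (compatQ_self hZ)
  · apply le_antisymm
    · refine (Cardinal.mk_set_le M).trans ?_
      simp
    · have h := Cardinal.mk_le_mk_of_subset hFM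
      rw [Cardinal.mk_range_eq F hinj] at h
      simpa using h
end

section
/- For each positive integer n, let B_n be the partial order on (Fin n) × ℚ defined by ⟨i,p⟩ < ⟨j,q⟩ iff i = j and p < q. Then the partial order ⟨ℙ(B_n), ⊆⟩ of copies of B_n contains a countably infinite maximal antichain. -/
/-- `A` is a copy of `⟨X,r⟩`: the restriction of `r` to `A` is isomorphic to `r`. -/
def IsCopyRel {X : Type*} (r : X → X → Prop) (A : Set X) : Prop :=
  Nonempty (Subrel r A ≃r r)

/-- Two copies are compatible if some copy is contained in both. -/
def CompatRel {X : Type*} (r : X → X → Prop) (A B : Set X) : Prop :=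
  ∃ C : Set X, IsCopyRel r C ∧ C ⊆ A ∧ C ⊆ B

/-- A maximal antichain in the poset of copies of `⟨X,r⟩`. -/
def IsMaxAntichainRel {X : Type*} (r : X → X → Prop) (𝒜 : Set (Set X)) : Prop :=
  (∀ A ∈ 𝒜, IsCopyRel r A) ∧
  (∀ A ∈ 𝒜, ∀ B ∈ 𝒜, A ≠ B → ¬ CompatRel r A B) ∧
  (∀ Z : Set X, IsCopyRel r Z → ∃ A ∈ 𝒜, CompatRel r Z A)

/-- The order `B_n` on `Fin n × ℚ`. -/
def Bn (n : ℕ) : Fin n × ℚ → Fin n × ℚ → Prop :=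
  fun a b => a.1 = b.1 ∧ a.2 < b.2

/-- Every fibre of a copy contains an increasing image of `ℚ`. -/
theorem copy_fibre (n : ℕ) (Z : Set (Fin n × ℚ)) (hZ : IsCopyRel (Bn n) Z) (i : Fin n) :
    ∃ e : ℚ → ℚ, StrictMono e ∧ ∀ q, (i, e q) ∈ Z := by
  obtain ⟨f⟩ := hZ
  have hlt : ∀ a b : Fin n × ℚ, Bn n a b → Bn n (f.symm a).1 (f.symm b).1 := by
    intro a b h
    exact f.symm.map_rel_iff.2 h
  have hlt' : ∀ a b : Fin n × ℚ, Bn n (f.symm a).1 (f.symm b).1 → Bn n a b := by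
    intro a b h
    exact f.symm.map_rel_iff.1 h
  have hinj : Function.Injective (fun j : Fin n => (f.symm (j, 0)).1.1) := by
    intro j j' h
    have h' : (f.symm (j, 0)).1.1 = (f.symm (j', 0)).1.1 := h
    rcases lt_trichotomy (f.symm (j, 0)).1.2 (f.symm (j', 0)).1.2 with h1 | h1 | h1
    · exact (hlt' _ _ ⟨h', h1⟩).1
    · have h2 : f.symm (j, 0) = f.symm (j', 0) := Subtype.ext (Prod.ext h' h1)
      exact congrArg Prod.fst (f.symm.injective h2)
    · exact (hlt' _ _ ⟨h'.symm, h1⟩).1.symm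
  obtain ⟨j, hj⟩ := (Finite.injective_iff_surjective.1 hinj) i
  have hj' : (f.symm (j, 0)).1.1 = i := hj
  have hfib : ∀ q, (f.symm (j, q)).1.1 = i := by
    intro q
    rcases lt_trichotomy q 0 with h | h | h
    · exact (hlt (j, q) (j, 0) ⟨rfl, h⟩).1.trans hj'
    · rw [h]; exact hj'
    · exact (hlt (j, 0) (j, q) ⟨rfl, h⟩).1.symm.trans hj'
  refine ⟨fun q => (f.symm (j, q)).1.2, fun a b h => (hlt (j, a) (j, b) ⟨rfl, h⟩).2, fun q => ?_⟩
  have : (i, (f.symm (j, q)).1.2) = (f.symm (j, q)).1 := Prod.ext (hfib q).symm rfl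
  rw [this]
  exact (f.symm (j, q)).2

/-- A fibrewise increasing image of `B_n` is a copy. -/
theorem copy_range (n : ℕ) (e : Fin n → ℚ → ℚ) (he : ∀ i, StrictMono (e i)) :
    IsCopyRel (Bn n) (Set.range fun p : Fin n × ℚ => (p.1, e p.1 p.2)) := by
  have hinj : Function.Injective (fun p : Fin n × ℚ => (p.1, e p.1 p.2)) := by
    rintro ⟨i, a⟩ ⟨j, b⟩ h
    simp only [Prod.mk.injEq] at h
    obtain ⟨rfl, h⟩ := h
    rw [(he i).injective h]
  refine ⟨RelIso.symm ⟨Equiv.ofInjective _ hinj, ?_⟩⟩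
  rintro ⟨i, a⟩ ⟨j, b⟩
  change (i = j ∧ e i a < e j b) ↔ (i = j ∧ a < b)
  constructor
  · rintro ⟨rfl, h⟩
    exact ⟨rfl, (he i).lt_iff_lt.1 h⟩
  · rintro ⟨rfl, h⟩
    exact ⟨rfl, he i h⟩

theorem ioo_iso (a b : ℚ) (h : a < b) :
    ∃ g : ℚ → ℚ, StrictMono g ∧ Set.range g = Set.Ioo a b := by
  have : Nonempty (Set.Ioo a b) := (Set.nonempty_Ioo.2 h).to_subtype
  obtain ⟨g⟩ := Order.iso_of_countable_dense ℚ (Set.Ioo a b)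
  refine ⟨fun q => (g q).1, fun x y hxy => g.strictMono hxy, ?_⟩
  ext x
  constructor
  · rintro ⟨q, rfl⟩
    exact (g q).2
  · intro hx
    exact ⟨g.symm ⟨x, hx⟩, by simp⟩

theorem same_floor (e : ℚ → ℚ) (he : StrictMono e) :
    ∃ x y : ℚ, x < y ∧ ⌊e x⌋ = ⌊e y⌋ := by
  have hinf : (Set.Ioo (0 : ℚ) 1).Infinite := Set.Ioo_infinite one_pos
  have hm : Set.MapsTo (fun q => ⌊e q⌋) (Set.Ioo (0 : ℚ) 1) (Set.Icc ⌊e 0⌋ ⌊e 1⌋) :=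
    fun q hq => ⟨Int.floor_mono (he hq.1).le, Int.floor_mono (he hq.2).le⟩
  obtain ⟨x, -, y, -, hne, h⟩ := hinf.exists_ne_map_eq_of_mapsTo hm (Set.finite_Icc _ _)
  rcases lt_or_gt_of_ne hne with h1 | h1
  · exact ⟨x, y, h1, h⟩
  · exact ⟨y, x, h1, h.symm⟩

theorem ioo_unique (k l : ℤ) (q : ℚ) (hk : q ∈ Set.Ioo (k : ℚ) (k + 1))
    (hl : q ∈ Set.Ioo (l : ℚ) (l + 1)) : k = l := by
  rw [← Int.floor_eq_iff.2 ⟨hk.1.le, hk.2⟩, ← Int.floor_eq_iff.2 ⟨hl.1.le, hl.2⟩]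

theorem Bn_has_countable_max_antichain (n : ℕ) (hn : 0 < n) :
    ∃ 𝒜 : Set (Set (Fin n × ℚ)), 𝒜.Countable ∧ 𝒜.Infinite ∧
      IsMaxAntichainRel (Bn n) 𝒜 := by
  let z : Fin n := ⟨0, hn⟩
  let A : ℤ → Set (Fin n × ℚ) := fun k => {p | p.1 = z → p.2 ∈ Set.Ioo (k : ℚ) (k + 1)}
  have hcopy : ∀ k, IsCopyRel (Bn n) (A k) := by
    intro k
    obtain ⟨g, hg, hr⟩ := ioo_iso (k : ℚ) (k + 1) (by linarith)
    have := copy_range n (fun i => if i = z then g else id) (by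
      intro i
      split_ifs
      · exact hg
      · exact strictMono_id)
    convert this using 1
    ext ⟨i, q⟩
    by_cases hi : i = z
    · simp only [A, Set.mem_ofPred_eq, ← hr]
      constructor
      · intro h
        obtain ⟨r, hr⟩ := h hi
        exact ⟨(i, r), by simp [hi, hr]⟩
      · rintro ⟨⟨j, r⟩, h⟩ -
        simp only [Prod.mk.injEq] at h
        obtain ⟨rfl, h⟩ := h
        rw [if_pos hi] at h
        exact ⟨r, h⟩
    · exact ⟨fun _ => ⟨(i, q), by simp [hi]⟩, fun _ h => absurd h hi⟩
  have hanti : ∀ k l, CompatRel (Bn n) (A k) (A l) → k = l := by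
    rintro k l ⟨C, hC, h1, h2⟩
    obtain ⟨e, -, he⟩ := copy_fibre n C hC z
    exact ioo_unique k l (e 0) (h1 (he 0) rfl) (h2 (he 0) rfl)
  have hinj : Function.Injective A := by
    intro k l h
    exact hanti k l ⟨A k, hcopy k, subset_rfl, h ▸ subset_rfl⟩
  refine ⟨Set.range A, Set.countable_range A, Set.infinite_range_of_injective hinj, ?_, ?_, ?_⟩
  · rintro _ ⟨k, rfl⟩
    exact hcopy k
  · rintro _ ⟨k, rfl⟩ _ ⟨l, rfl⟩ hne hc
    exact hne (congrArg A (hanti k l hc))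
  · intro Z hZ
    choose e he hm using copy_fibre n Z hZ
    obtain ⟨x, y, hxy, hf⟩ := same_floor (e z) (he z)
    obtain ⟨g, hg, hr⟩ := ioo_iso x y hxy
    refine ⟨_, ⟨⌊e z x⌋, rfl⟩, _, copy_range n (fun i => e i ∘ g) (fun i => (he i).comp hg), ?_, ?_⟩
    · rintro _ ⟨p, rfl⟩
      exact hm _ _
    · rintro _ ⟨⟨i, q⟩, rfl⟩ hi
      have hi' : i = z := hi
      subst hi'
      have hq : g q ∈ Set.Ioo x y := hr ▸ Set.mem_range_self q
      refine ⟨(Int.floor_le _).trans_lt (he _ hq.1), (he _ hq.2).trans ?_⟩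
      rw [hf]
      exact Int.lt_floor_add_one _
end

section
/- Let B_ω be the partial order on ℕ × ℚ defined by ⟨i,p⟩ < ⟨j,q⟩ iff i = j and p < q. Then every infinite maximal antichain in the partial order ⟨ℙ(B_ω), ⊆⟩ of copies of B_ω is uncountable. -/
/-- The order `B_ω` on `ℕ × ℚ`. -/
def Bw : ℕ × ℚ → ℕ × ℚ → Prop :=
  fun a b => a.1 = b.1 ∧ a.2 < b.2

/-- `s` contains a copy of the rationals. -/
def NonScat (s : Set ℚ) : Prop := ∃ f : ℚ → ℚ, StrictMono f ∧ ∀ q, f q ∈ s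

lemma NonScat.mono {s t : Set ℚ} (h : NonScat s) (hst : s ⊆ t) : NonScat t := by
  obtain ⟨f, hf, hs⟩ := h
  exact ⟨f, hf, fun q => hst (hs q)⟩

lemma NonScat.union {s t : Set ℚ} (h : NonScat (s ∪ t)) : NonScat s ∨ NonScat t := by
  obtain ⟨f, hf, hs⟩ := h
  by_cases hd : ∃ a b : ℚ, a < b ∧ ∀ x, a < x → x < b → f x ∉ s
  · obtain ⟨a, b, hab, hx⟩ := hd
    right
    have : Nontrivial (Set.Ioo a b) := by
      obtain ⟨c, hac, hcb⟩ := exists_between hab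
      obtain ⟨d, hcd, hdb⟩ := exists_between hcb
      exact ⟨⟨c, hac, hcb⟩, ⟨d, hac.trans hcd, hdb⟩, fun h => hcd.ne (congrArg Subtype.val h)⟩
    obtain ⟨e⟩ := Order.embedding_from_countable_to_dense ℚ (Set.Ioo a b)
    refine ⟨fun q => f (e q), fun x y hxy => hf (e.strictMono hxy), fun q => ?_⟩
    exact (hs _).resolve_left (hx _ (e q).2.1 (e q).2.2)
  · push Not at hd
    left
    have : DenselyOrdered {x : ℚ // f x ∈ s} := ⟨by
      rintro ⟨a, ha⟩ ⟨b, hb⟩ hab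
      obtain ⟨x, h1, h2, h3⟩ := hd a b hab
      exact ⟨⟨x, h3⟩, h1, h2⟩⟩
    have : Nontrivial {x : ℚ // f x ∈ s} := by
      obtain ⟨x, _, h1, hx⟩ := hd 0 1 (by norm_num)
      obtain ⟨y, h2, _, hy⟩ := hd 1 2 (by norm_num)
      exact ⟨⟨x, hx⟩, ⟨y, hy⟩, fun h => (h1.trans h2).ne (congrArg Subtype.val h)⟩
    obtain ⟨e⟩ := Order.embedding_from_countable_to_dense ℚ {x : ℚ // f x ∈ s}
    exact ⟨fun q => f (e q), fun x y hxy => hf (e.strictMono hxy), fun q => (e q).2⟩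

/-- Infinitely many fibres of `S` contain a copy of the rationals. -/
def LargeSet (S : Set (ℕ × ℚ)) : Prop :=
  ∃ᶠ i in Filter.atTop, NonScat {q | (i, q) ∈ S}

lemma LargeSet.mono {S T : Set (ℕ × ℚ)} (h : LargeSet S) (hst : S ⊆ T) : LargeSet T :=
  Filter.Frequently.mono h fun _ hi => hi.mono fun _ hq => hst hq

lemma LargeSet.union {S T : Set (ℕ × ℚ)} (h : LargeSet (S ∪ T)) : LargeSet S ∨ LargeSet T := by
  unfold LargeSet at *
  rw [← Filter.frequently_or_distrib]
  exact h.mono fun i hi => NonScat.union hi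

lemma isCopy_range (g : ℕ → ℕ) (hg : StrictMono g) (F : ℕ → ℚ → ℚ) (hF : ∀ n, StrictMono (F n)) :
    IsCopyRel Bw (Set.range fun p : ℕ × ℚ => (g p.1, F p.1 p.2)) := by
  have hinj : Function.Injective (fun p : ℕ × ℚ => (g p.1, F p.1 p.2)) := by
    rintro ⟨n, q⟩ ⟨m, r⟩ h
    simp only [Prod.mk.injEq] at h
    obtain ⟨h1, h2⟩ := h
    obtain rfl := hg.injective h1
    rw [(hF n).injective h2]
  refine ⟨RelIso.symm ⟨Equiv.ofInjective _ hinj, ?_⟩⟩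
  rintro ⟨n, q⟩ ⟨m, r⟩
  show (g n = g m ∧ F n q < F m r) ↔ (n = m ∧ q < r)
  rw [hg.injective.eq_iff]
  constructor
  · rintro ⟨rfl, h⟩
    exact ⟨rfl, (hF n).lt_iff_lt.1 h⟩
  · rintro ⟨rfl, h⟩
    exact ⟨rfl, hF n h⟩

lemma IsCopyRel.large {C : Set (ℕ × ℚ)} (h : IsCopyRel Bw C) : LargeSet C := by
  obtain ⟨e0⟩ := h
  let e := e0.symm
  have he : ∀ p q : ℕ × ℚ, Bw (e p).1 (e q).1 ↔ Bw p q := fun p q => e.map_rel_iff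
  have hk : ∀ n q, (e (n, q)).1.1 = (e (n, 0)).1.1 := by
    intro n q
    rcases lt_trichotomy q 0 with h | rfl | h
    · exact ((he (n, q) (n, 0)).2 ⟨rfl, h⟩).1
    · rfl
    · exact ((he (n, 0) (n, q)).2 ⟨rfl, h⟩).1.symm
  have hinj : Function.Injective (fun n : ℕ => (e (n, 0)).1.1) := by
    intro n m hnm
    simp only at hnm
    rcases lt_trichotomy (e (n, 0)).1.2 (e (m, 0)).1.2 with h | h | h
    · exact ((he (n, 0) (m, 0)).1 ⟨hnm, h⟩).1
    · have : e (n, 0) = e (m, 0) := Subtype.ext (Prod.ext hnm h)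
      exact congrArg Prod.fst (e.injective this)
    · exact ((he (m, 0) (n, 0)).1 ⟨hnm.symm, h⟩).1.symm
  unfold LargeSet
  rw [Nat.frequently_atTop_iff_infinite]
  refine (Set.infinite_range_of_injective hinj).mono ?_
  rintro _ ⟨n, rfl⟩
  refine ⟨fun q => (e (n, q)).1.2, fun x y hxy => ((he (n, x) (n, y)).2 ⟨rfl, hxy⟩).2, fun q => ?_⟩
  show ((e (n, 0)).1.1, (e (n, q)).1.2) ∈ C
  rw [← hk n q]
  exact (e (n, q)).2

lemma exists_copies (S : ℕ → Set (ℕ × ℚ)) (h : ∀ n, LargeSet (S n)) :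
    ∃ (g : ℕ → ℕ) (F : ℕ → ℚ → ℚ), StrictMono g ∧ (∀ n, StrictMono (F n)) ∧
      ∀ n q, (g n, F n q) ∈ S n := by
  obtain ⟨g, hg, hP⟩ := Filter.extraction_forall_of_frequently h
  choose F hF hS using hP
  exact ⟨g, F, hg, hF, hS⟩

lemma compat_of_large {A B : Set (ℕ × ℚ)} (h : LargeSet (A ∩ B)) : CompatRel Bw A B := by
  obtain ⟨g, F, hg, hF, hS⟩ := exists_copies (fun _ => A ∩ B) (fun _ => h)
  refine ⟨_, isCopy_range g hg F hF, ?_, ?_⟩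
  · rintro _ ⟨⟨n, q⟩, rfl⟩
    exact (hS n q).1
  · rintro _ ⟨⟨n, q⟩, rfl⟩
    exact (hS n q).2

theorem Bw_infinite_max_antichains_are_uncountable
    (𝒜 : Set (Set (ℕ × ℚ))) (h : IsMaxAntichainRel Bw 𝒜) (hinf : 𝒜.Infinite) :
    ¬ 𝒜.Countable := by
  intro hc
  obtain ⟨hcopy, hanti, hmax⟩ := h
  have := hinf.to_subtype
  have := hc.to_subtype
  obtain ⟨E⟩ : Nonempty (ℕ ≃ 𝒜) := by
    obtain ⟨d⟩ := nonempty_denumerable 𝒜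
    exact ⟨(Denumerable.eqv 𝒜).symm⟩
  have hB : ∀ n, LargeSet {p | p ∈ (E n).1 ∧ ∀ m < n, p ∉ (E m).1} := by
    intro n
    have key : ∀ k ≤ n, LargeSet {p | p ∈ (E n).1 ∧ ∀ m < k, p ∉ (E m).1} := by
      intro k
      induction k with
      | zero =>
        intro _
        exact (hcopy _ (E n).2).large.mono fun p hp => ⟨hp, fun m hm => absurd hm (by omega)⟩
      | succ k ih =>
        intro hk
        have h1 := (ih (by omega)).mono
          (T := {p | p ∈ (E n).1 ∧ ∀ m < k + 1, p ∉ (E m).1} ∪ ((E n).1 ∩ (E k).1)) (by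
            rintro p ⟨hp, hp2⟩
            by_cases hpk : p ∈ (E k).1
            · exact Or.inr ⟨hp, hpk⟩
            · refine Or.inl ⟨hp, fun m hm => ?_⟩
              rcases Nat.lt_succ_iff_lt_or_eq.1 hm with h | rfl
              · exact hp2 m h
              · exact hpk)
        refine h1.union.resolve_right fun h2 => ?_
        refine hanti _ (E n).2 _ (E k).2 (fun h3 => ?_) (compat_of_large h2)
        have := E.injective (Subtype.ext h3)
        omega
    exact key n le_rfl
  obtain ⟨g, F, hg, hF, hS⟩ := exists_copies _ hB
  obtain ⟨A, hA, C, hC, hCZ, hCA⟩ := hmax _ (isCopy_range g hg F hF)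
  obtain ⟨m, hm⟩ := E.surjective ⟨A, hA⟩
  obtain ⟨i, hi, f, _, hf⟩ := Filter.frequently_atTop.1 hC.large (g m + 1)
  have h0 := hf 0
  obtain ⟨⟨n, q⟩, hnq⟩ := hCZ h0
  simp only [Prod.mk.injEq] at hnq
  obtain ⟨h1, h2⟩ := hnq
  have hmn : m < n := hg.lt_iff_lt.1 (by omega)
  refine (hS n q).2 m hmn ?_
  rw [hm, h1, h2]
  exact hCA h0
end

section
/- Let S be a nonempty countable set and let C_S be the partial order on S × ℚ defined by ⟨i,p⟩ < ⟨j,q⟩ iff p < q. If 𝒜 is a maximal antichain in ℙ(ℚ), then ℬ = {S × A : A ∈ 𝒜} is a maximal antichain in ⟨ℙ(C_S), ⊆⟩, and ℬ has the same cardinality as 𝒜. -/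
/-- The order `C_S` on `S × ℚ`: `⟨i,p⟩ < ⟨j,q⟩` iff `p < q`. -/
def Cord (S : Type*) : S × ℚ → S × ℚ → Prop :=
  fun a b => a.2 < b.2


theorem cs_fiber_eq {S : Type} {Z : Set (S × ℚ)} (f : Subrel (Cord S) (· ∈ Z) ≃r Cord S)
    (x y : Z) : (x : S × ℚ).2 = (y : S × ℚ).2 ↔ (f x).2 = (f y).2 := by
  have h1 : (f x).2 < (f y).2 ↔ x.1.2 < y.1.2 := f.map_rel_iff (a := x) (b := y)
  have h2 : (f y).2 < (f x).2 ↔ y.1.2 < x.1.2 := f.map_rel_iff (a := y) (b := x)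
  constructor
  · intro h
    rw [h] at h1 h2
    exact le_antisymm (not_lt.1 fun hlt => lt_irrefl _ (h2.1 hlt))
      (not_lt.1 fun hlt => lt_irrefl _ (h1.1 hlt))
  · intro h
    rw [h] at h1 h2
    exact le_antisymm (not_lt.1 fun hlt => lt_irrefl _ (h2.2 hlt))
      (not_lt.1 fun hlt => lt_irrefl _ (h1.2 hlt))

theorem cs_copy_proj {S : Type} [Nonempty S] {Z : Set (S × ℚ)} (hZ : IsCopyRel (Cord S) Z) :
    IsCopyRel ((· < ·) : ℚ → ℚ → Prop) (Prod.snd '' Z) ∧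
    ∀ q ∈ Prod.snd '' Z, Nonempty ({s : S // (s, q) ∈ Z} ≃ S) := by
  obtain ⟨f⟩ := hZ
  change Subrel (Cord S) (· ∈ Z) ≃r Cord S at f
  have key := cs_fiber_eq f
  obtain ⟨s0⟩ := ‹Nonempty S›
  constructor
  · let φ : ℚ → ℚ := fun p => (f.symm (s0, p)).1.2
    have hφ : StrictMono φ := by
      intro p q hpq
      exact f.symm.map_rel_iff (a := (s0, p)) (b := (s0, q)).2 hpq
    have hr : Prod.snd '' Z = Set.range φ := by
      ext q
      constructor
      · rintro ⟨z, hz, rfl⟩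
        refine ⟨(f ⟨z, hz⟩).2, ?_⟩
        exact (key (f.symm (s0, (f ⟨z, hz⟩).2)) ⟨z, hz⟩).2 (by simp)
      · rintro ⟨p, rfl⟩
        exact ⟨_, (f.symm (s0, p)).2, rfl⟩
    rw [hr]
    exact ⟨(hφ.orderIso φ).symm.toRelIsoLT⟩
  · rintro q ⟨z, hz, rfl⟩
    refine ⟨Equiv.ofBijective (fun s => (f ⟨(s.1, z.2), s.2⟩).1) ⟨?_, ?_⟩⟩
    · intro a b hab
      have h2 := (key ⟨(a.1, z.2), a.2⟩ ⟨(b.1, z.2), b.2⟩).1 rfl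
      have h3 := f.injective (Prod.ext hab h2)
      apply Subtype.ext
      exact congrArg (fun w : Z => w.1.1) h3
    · intro t
      have h1 := (key (f.symm (t, (f ⟨z, hz⟩).2)) ⟨z, hz⟩).2 (by simp)
      simp only at h1
      have h2 : ((f.symm (t, (f ⟨z, hz⟩).2)).1.1, z.2) = (f.symm (t, (f ⟨z, hz⟩).2)).1 :=
        Prod.ext rfl h1.symm
      refine ⟨⟨(f.symm (t, (f ⟨z, hz⟩).2)).1.1, ?_⟩, ?_⟩
      · rw [h2]; exact (f.symm (t, (f ⟨z, hz⟩).2)).2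
      · simp only [h2]
        simp

theorem cs_copy_mk {S : Type} {Z : Set (S × ℚ)} {C : Set ℚ}
    (hC : IsCopyRel ((· < ·) : ℚ → ℚ → Prop) C) (hZ : ∀ z ∈ Z, z.2 ∈ C)
    (hf : ∀ q ∈ C, Nonempty ({s : S // (s, q) ∈ Z} ≃ S)) : IsCopyRel (Cord S) Z := by
  obtain ⟨e⟩ := hC
  change Subrel ((· < ·) : ℚ → ℚ → Prop) (· ∈ C) ≃r ((· < ·) : ℚ → ℚ → Prop) at e
  have g := fun q hq => Classical.choice (hf q hq)
  let F : Z → S × ℚ := fun z => (g z.1.2 (hZ _ z.2) ⟨z.1.1, z.2⟩, e ⟨z.1.2, hZ _ z.2⟩)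
  have hF : Function.Bijective F := by
    constructor
    · rintro ⟨⟨s, q⟩, hz⟩ ⟨⟨s2, q2⟩, hz2⟩ h
      have h2 := e.injective (congrArg Prod.snd h)
      have h3 : q = q2 := congrArg Subtype.val h2
      subst h3
      have h1 := (g q _).injective (congrArg Prod.fst h)
      have h4 : s = s2 := congrArg Subtype.val h1
      subst h4
      rfl
    · rintro ⟨t, p⟩
      obtain ⟨⟨q, hq⟩, rfl⟩ := e.surjective p
      obtain ⟨⟨s, hs⟩, rfl⟩ := (g q hq).surjective t
      exact ⟨⟨(s, q), hs⟩, rfl⟩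
  refine ⟨⟨Equiv.ofBijective F hF, ?_⟩⟩
  intro a b
  exact e.map_rel_iff (a := ⟨a.1.2, hZ _ a.2⟩) (b := ⟨b.1.2, hZ _ b.2⟩)

theorem max_antichain_transfer_to_CS (S : Type) [Countable S] [Nonempty S]
    (𝒜 : Set (Set ℚ)) (h : IsMaxAntichainRel ((· < ·) : ℚ → ℚ → Prop) 𝒜) :
    IsMaxAntichainRel (Cord S) ((fun A => (Set.univ : Set S) ×ˢ A) '' 𝒜) ∧
    Cardinal.mk ((fun A => (Set.univ : Set S) ×ˢ A) '' 𝒜) = Cardinal.mk 𝒜 := by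
  obtain ⟨h1, h2, h3⟩ := h
  refine ⟨⟨?_, ?_, ?_⟩, ?_⟩
  · rintro _ ⟨A, hA, rfl⟩
    refine cs_copy_mk (h1 A hA) (fun z hz => hz.2) ?_
    intro q hq
    exact ⟨Equiv.subtypeUnivEquiv fun s => ⟨trivial, hq⟩⟩
  · rintro _ ⟨A, hA, rfl⟩ _ ⟨B, hB, rfl⟩ hne ⟨Z, hZ, hZA, hZB⟩
    refine h2 A hA B hB (fun hAB => hne (by rw [hAB])) ⟨_, (cs_copy_proj hZ).1, ?_, ?_⟩
    · rintro _ ⟨z, hz, rfl⟩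
      exact (hZA hz).2
    · rintro _ ⟨z, hz, rfl⟩
      exact (hZB hz).2
  · intro Z hZ
    obtain ⟨hp, hfib⟩ := cs_copy_proj hZ
    obtain ⟨A, hA, C, hC, hCZ, hCA⟩ := h3 _ hp
    refine ⟨_, ⟨A, hA, rfl⟩, {z | z ∈ Z ∧ z.2 ∈ C}, ?_, fun z hz => hz.1,
      fun z hz => ⟨trivial, hCA hz.2⟩⟩
    refine cs_copy_mk hC (fun z hz => hz.2) ?_
    intro q hq
    obtain ⟨g⟩ := hfib q (hCZ hq)
    exact ⟨(Equiv.subtypeEquivRight fun s => ⟨fun hs => hs.1, fun hs => ⟨hs, hq⟩⟩).trans g⟩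
  · apply Cardinal.mk_image_eq
    intro A B hAB
    obtain ⟨s0⟩ := ‹Nonempty S›
    ext q
    have := Set.ext_iff.1 hAB (s0, q)
    simpa using this
end

section
/- Let S be a nonempty countable set and let C_S be the partial order on S × ℚ defined by ⟨i,p⟩ < ⟨j,q⟩ iff p < q. Then the partial order ⟨ℙ(C_S), ⊆⟩ of copies of C_S contains a countably infinite maximal antichain and also a maximal antichain of cardinality 2^ℵ₀. -/
theorem CSaux_isCopy_range {X : Type*} {r : X → X → Prop} (g : r ↪r r) :
    IsCopyRel r (Set.range g) := by
  refine ⟨RelIso.symm ⟨Equiv.ofInjective g g.injective, ?_⟩⟩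
  intro a b
  exact g.map_rel_iff

/-- The relation embedding induced by an order embedding of the rationals. -/
def CSaux_emb (S : Type*) (f : ℚ ↪o ℚ) : Cord S ↪r Cord S where
  toFun a := (a.1, f a.2)
  inj' := by
    rintro ⟨a, p⟩ ⟨b, q⟩ h
    simpa using h
  map_rel_iff' := by
    rintro ⟨a, p⟩ ⟨b, q⟩
    exact f.lt_iff_lt

theorem CSaux_copy_of_dense (L : Set ℚ) (h1 : Nonempty L)
    (h2 : DenselyOrdered L) (h3 : NoMinOrder L) (h4 : NoMaxOrder L) :
    ∃ f : ℚ ↪o ℚ, Set.range f = L := by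
  obtain ⟨e⟩ := Order.iso_of_countable_dense ℚ L
  refine ⟨e.toOrderEmbedding.trans (OrderEmbedding.subtype (· ∈ L)), ?_⟩
  ext x
  constructor
  · rintro ⟨y, rfl⟩
    exact (e y).2
  · intro hx
    exact ⟨e.symm ⟨x, hx⟩, by simp⟩

theorem CSaux_copy (S : Type*) (f : ℚ ↪o ℚ) :
    IsCopyRel (Cord S) {a : S × ℚ | a.2 ∈ Set.range f} := by
  have : {a : S × ℚ | a.2 ∈ Set.range f} = Set.range (CSaux_emb S f) := by
    ext ⟨i, p⟩
    constructor
    · rintro ⟨y, hy⟩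
      exact ⟨(i, y), Prod.ext rfl hy⟩
    · rintro ⟨⟨j, y⟩, hy⟩
      exact ⟨y, congrArg Prod.snd hy⟩
  rw [this]
  exact CSaux_isCopy_range _

theorem CSaux_Ioo (c d : ℚ) (h : c < d) : ∃ f : ℚ ↪o ℚ, Set.range f = Set.Ioo c d :=
  CSaux_copy_of_dense _ (Set.nonempty_Ioo_subtype h) inferInstance inferInstance
    inferInstance

/-- Section of a copy: a relation embedding with range the copy. -/
theorem CSaux_copy_emb {X : Type*} {r : X → X → Prop} {A : Set X} (h : IsCopyRel r A) :
    ∃ g : r ↪r r, Set.range g = A := by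
  obtain ⟨e⟩ := h
  refine ⟨e.symm.toRelEmbedding.trans (Subrel.relEmbedding r A), ?_⟩
  ext x
  constructor
  · rintro ⟨y, rfl⟩
    exact (e.symm y).2
  · intro hx
    exact ⟨e ⟨x, hx⟩, congrArg Subtype.val (e.symm_apply_apply ⟨x, hx⟩)⟩

theorem CSaux_copy_infinite {S : Type*} [Nonempty S] {A : Set (S × ℚ)}
    (h : IsCopyRel (Cord S) A) : (Prod.snd '' A).Infinite := by
  obtain ⟨g, rfl⟩ := CSaux_copy_emb h
  obtain ⟨s⟩ := ‹Nonempty S›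
  have hm : StrictMono (fun q : ℚ => (g (s, q)).2) := fun p q hpq =>
    (g.map_rel_iff (a := (s, p)) (b := (s, q))).2 hpq
  refine (Set.infinite_range_of_injective hm.injective).mono ?_
  rintro _ ⟨q, rfl⟩
  exact ⟨_, ⟨_, rfl⟩, rfl⟩

theorem CSaux_injective_choice {α : Type*} [Encodable α] (U : α → Set ℚ)
    (hU : ∀ a, (U a).Infinite) : ∃ f : α → ℚ, Function.Injective f ∧ ∀ a, f a ∈ U a := by
  classical
  let V : ℕ → Set ℚ := fun n => match Encodable.decode (α := α) n with
    | some a => U a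
    | none => Set.univ
  have hV : ∀ n, (V n).Infinite := by
    intro n
    simp only [V]
    split
    · exact hU _
    · exact Set.infinite_univ
  have hc : ∀ n, ∀ s : Finset ℚ, ∃ q, q ∈ V n ∧ q ∉ s := fun n s =>
    (hV n).exists_notMem_finset s
  choose c hc1 hc2 using hc
  let F : ℕ → Finset ℚ := fun n => Nat.rec ∅ (fun k s => insert (c k s) s) n
  have hF : ∀ n, F (n+1) = insert (c n (F n)) (F n) := fun n => rfl
  have hmono : Monotone F := monotone_nat_of_le_succ fun n => by
    rw [hF]; exact Finset.subset_insert _ _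
  have key : ∀ m n, m < n → c m (F m) ≠ c n (F n) := by
    intro m n hmn he
    apply hc2 n (F n)
    rw [← he]
    apply hmono (Nat.succ_le_of_lt hmn)
    rw [hF]
    exact Finset.mem_insert_self _ _
  refine ⟨fun a => c (Encodable.encode a) (F (Encodable.encode a)), ?_, ?_⟩
  · intro a b hab
    apply Encodable.encode_injective
    rcases lt_trichotomy (Encodable.encode a) (Encodable.encode b) with h | h | h
    · exact absurd hab (key _ _ h)
    · exact h
    · exact absurd hab.symm (key _ _ h)
  · intro a
    have := hc1 (Encodable.encode a) (F (Encodable.encode a))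
    simpa [V] using this

/-- Continuum many dense subsets of the rationals, pairwise with finite intersections. -/
theorem CSaux_family : ∃ L : (ℕ → Bool) → Set ℚ,
    (∀ x, ∀ a b : ℚ, a < b → ∃ c ∈ L x, a < c ∧ c < b) ∧
    (∀ x y, x ≠ y → (L x ∩ L y).Finite) := by
  obtain ⟨f, hf, hfU⟩ := CSaux_injective_choice
    (α := {p : ℚ × ℚ // p.1 < p.2} × List Bool) (fun t => Set.Ioo t.1.1.1 t.1.1.2)
    (fun t => Set.Ioo_infinite t.1.2)
  refine ⟨fun x => Set.range fun p => f (p, (List.range (Encodable.encode p)).map x), ?_, ?_⟩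
  · intro x a b hab
    exact ⟨_, ⟨⟨(a, b), hab⟩, rfl⟩, hfU (⟨(a, b), hab⟩, _)⟩
  · intro x y hxy
    obtain ⟨m, hm⟩ := Function.ne_iff.1 hxy
    have hfin : {p : {p : ℚ × ℚ // p.1 < p.2} | Encodable.encode p ≤ m}.Finite :=
      (Set.finite_Iic m).preimage (Encodable.encode_injective.injOn)
    refine (hfin.image fun p => f (p, (List.range (Encodable.encode p)).map x)).subset ?_
    rintro _ ⟨⟨p, rfl⟩, ⟨q, hq⟩⟩
    refine ⟨p, ?_, rfl⟩
    have h := hf hq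
    simp only [Prod.mk.injEq] at h
    obtain ⟨rfl, h⟩ := h
    by_contra hlt
    simp only [Set.mem_ofPred_eq, not_le] at hlt
    exact hm (List.map_inj_left.1 h m (List.mem_range.2 hlt)).symm

theorem CSaux_dense_emb (L : Set ℚ) (h : ∀ a b : ℚ, a < b → ∃ c ∈ L, a < c ∧ c < b) :
    ∃ f : ℚ ↪o ℚ, Set.range f = L := by
  apply CSaux_copy_of_dense
  · obtain ⟨c, hc, -⟩ := h 0 1 one_pos
    exact ⟨⟨c, hc⟩⟩
  · refine ⟨fun a b hab => ?_⟩
    obtain ⟨c, hc, h1, h2⟩ := h a b hab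
    exact ⟨⟨c, hc⟩, h1, h2⟩
  · refine ⟨fun a => ?_⟩
    obtain ⟨c, hc, h1, h2⟩ := h (a - 1) a (by linarith)
    exact ⟨⟨c, hc⟩, h2⟩
  · refine ⟨fun a => ?_⟩
    obtain ⟨c, hc, h1, h2⟩ := h a (a + 1) (by linarith)
    exact ⟨⟨c, hc⟩, h1⟩

theorem CSaux_extend {X : Type*} (r : X → X → Prop) (𝒜 : Set (Set X))
    (h1 : ∀ A ∈ 𝒜, IsCopyRel r A)
    (h2 : ∀ A ∈ 𝒜, ∀ B ∈ 𝒜, A ≠ B → ¬ CompatRel r A B) :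
    ∃ ℬ, 𝒜 ⊆ ℬ ∧ IsMaxAntichainRel r ℬ := by
  obtain ⟨ℬ, hsub, hmax⟩ := zorn_subset_nonempty
    {ℬ : Set (Set X) | (∀ A ∈ ℬ, IsCopyRel r A) ∧
      (∀ A ∈ ℬ, ∀ B ∈ ℬ, A ≠ B → ¬ CompatRel r A B)} (by
      intro c hc hchain _
      refine ⟨⋃₀ c, ⟨?_, ?_⟩, fun s hs => Set.subset_sUnion_of_mem hs⟩
      · rintro A ⟨s, hs, hA⟩
        exact (hc hs).1 A hA
      · rintro A ⟨s, hs, hA⟩ B ⟨t, ht, hB⟩ hne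
        rcases hchain.total hs ht with h | h
        · exact (hc ht).2 A (h hA) B hB hne
        · exact (hc hs).2 A hA B (h hB) hne) 𝒜 ⟨h1, h2⟩
  refine ⟨ℬ, hsub, hmax.prop.1, hmax.prop.2, ?_⟩
  intro Z hZ
  by_contra! hcon
  have hsymm : ∀ A B, CompatRel r A B → CompatRel r B A :=
    fun A B ⟨C, a, b, c⟩ => ⟨C, a, c, b⟩
  have hins : Z ∈ ℬ := by
    apply hmax.le_of_ge (y := insert Z ℬ) ?_ (Set.subset_insert _ _) (Set.mem_insert _ _)
    constructor
    · rintro A (rfl | hA)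
      · exact hZ
      · exact hmax.prop.1 A hA
    · rintro A (rfl | hA) B (rfl | hB) hne
      · exact absurd rfl hne
      · exact hcon B hB
      · exact fun h => hcon A hA (hsymm _ _ h)
      · exact hmax.prop.2 A hA B hB hne
  exact hcon Z hins ⟨Z, hZ, subset_rfl, subset_rfl⟩

theorem CSaux_part_one (S : Type*) [Nonempty S] :
    ∃ 𝒜 : Set (Set (S × ℚ)), 𝒜.Countable ∧ 𝒜.Infinite ∧
      IsMaxAntichainRel (Cord S) 𝒜 := by
  let A : ℤ → Set (S × ℚ) := fun n => {a | a.2 ∈ Set.Ioo (n : ℚ) (n + 1)}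
  have hfloor : ∀ n a, a ∈ A n → ⌊a.2⌋ = n := fun n a ha =>
    Int.floor_eq_iff.2 ⟨ha.1.le, ha.2⟩
  have hcopy : ∀ n, IsCopyRel (Cord S) (A n) := by
    intro n
    obtain ⟨f, hf⟩ := CSaux_Ioo (n : ℚ) (n + 1) (by linarith)
    have := CSaux_copy S f
    rwa [hf] at this
  have hinc : ∀ m n, CompatRel (Cord S) (A m) (A n) → m = n := by
    rintro m n ⟨C, hC, h1, h2⟩
    obtain ⟨_, a, ha, rfl⟩ := (CSaux_copy_infinite hC).nonempty
    rw [← hfloor m a (h1 ha), hfloor n a (h2 ha)]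
  refine ⟨Set.range A, Set.countable_range A, ?_, ?_, ?_, ?_⟩
  · apply Set.infinite_range_of_injective
    intro m n hmn
    exact hinc m n ⟨A m, hcopy m, subset_rfl, hmn.subset⟩
  · rintro _ ⟨n, rfl⟩
    exact hcopy n
  · rintro _ ⟨m, rfl⟩ _ ⟨n, rfl⟩ hne h
    exact hne (congrArg A (hinc m n h))
  · intro Z hZ
    obtain ⟨g, rfl⟩ := CSaux_copy_emb hZ
    obtain ⟨s⟩ := ‹Nonempty S›
    have hlt : ∀ a b : S × ℚ, a.2 < b.2 → (g a).2 < (g b).2 := fun a b hab =>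
      (g.map_rel_iff (a := a) (b := b)).2 hab
    let h : ℚ → ℚ := fun q => (g (s, q)).2
    have hm : StrictMono h := fun p q hpq => hlt (s, p) (s, q) hpq
    have hpig : ∃ c d : ℚ, c < d ∧ ⌊h c⌋ = ⌊h d⌋ := by
      obtain ⟨c, -, d, -, hne, he⟩ := (Set.Icc_infinite (zero_lt_one (α := ℚ))).exists_ne_map_eq_of_mapsTo
        (f := fun q => ⌊h q⌋) (t := Set.Icc ⌊h 0⌋ ⌊h 1⌋)
        (fun q hq => ⟨Int.floor_mono (hm.monotone hq.1), Int.floor_mono (hm.monotone hq.2)⟩)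
        (Set.finite_Icc _ _)
      rcases lt_or_gt_of_ne hne with h | h
      · exact ⟨c, d, h, he⟩
      · exact ⟨d, c, h, he.symm⟩
    obtain ⟨c, d, hcd, he⟩ := hpig
    obtain ⟨f, hf⟩ := CSaux_Ioo c d hcd
    refine ⟨_, ⟨⌊h c⌋, rfl⟩, Set.range ((CSaux_emb S f).trans g), CSaux_isCopy_range _, ?_, ?_⟩
    · rintro _ ⟨a, rfl⟩
      exact ⟨_, rfl⟩
    · rintro _ ⟨a, rfl⟩
      have hfa : f a.2 ∈ Set.Ioo c d := hf ▸ Set.mem_range_self _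
      have h1 : h c < (g (CSaux_emb S f a)).2 := hlt (s, c) (CSaux_emb S f a) hfa.1
      have h2 : (g (CSaux_emb S f a)).2 < h d := hlt (CSaux_emb S f a) (s, d) hfa.2
      refine ⟨(Int.floor_le (h c)).trans_lt h1, h2.trans ?_⟩
      rw [he]
      exact Int.lt_floor_add_one _

theorem CSaux_part_two (S : Type*) [Countable S] [Nonempty S] :
    ∃ 𝒜 : Set (Set (S × ℚ)), Cardinal.mk 𝒜 = Cardinal.continuum ∧
      IsMaxAntichainRel (Cord S) 𝒜 := by
  obtain ⟨L, hL, hfin⟩ := CSaux_family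
  let A : (ℕ → Bool) → Set (S × ℚ) := fun x => {a | a.2 ∈ L x}
  have hcopy : ∀ x, IsCopyRel (Cord S) (A x) := by
    intro x
    obtain ⟨f, hf⟩ := CSaux_dense_emb (L x) (hL x)
    have := CSaux_copy S f
    rwa [hf] at this
  have hinc : ∀ x y, CompatRel (Cord S) (A x) (A y) → x = y := by
    rintro x y ⟨C, hC, h1, h2⟩
    by_contra hne
    refine CSaux_copy_infinite hC ((hfin x y hne).subset ?_)
    rintro _ ⟨a, ha, rfl⟩
    exact ⟨h1 ha, h2 ha⟩
  have hinj : Function.Injective A := fun x y hxy =>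
    hinc x y ⟨A x, hcopy x, subset_rfl, hxy.subset⟩
  obtain ⟨ℬ, hsub, hmax⟩ := CSaux_extend (Cord S) (Set.range A)
    (by rintro _ ⟨n, rfl⟩; exact hcopy n)
    (by rintro _ ⟨m, rfl⟩ _ ⟨n, rfl⟩ hne h; exact hne (congrArg A (hinc m n h)))
  refine ⟨ℬ, le_antisymm ?_ ?_, hmax⟩
  · refine (Cardinal.mk_set_le ℬ).trans ?_
    rw [Cardinal.mk_set, ← Cardinal.two_power_aleph0]
    exact Cardinal.power_le_power_left two_ne_zero Cardinal.mk_le_aleph0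
  · have := Cardinal.lift_mk_le_lift_mk_of_injective
      (f := fun x => (⟨A x, hsub ⟨x, rfl⟩⟩ : ℬ))
      (fun x y hxy => hinj (congrArg Subtype.val hxy))
    simpa using this

theorem CS_max_antichains (S : Type*) [Countable S] [Nonempty S] :
    (∃ 𝒜 : Set (Set (S × ℚ)), 𝒜.Countable ∧ 𝒜.Infinite ∧
      IsMaxAntichainRel (Cord S) 𝒜) ∧
    (∃ 𝒜 : Set (Set (S × ℚ)), Cardinal.mk 𝒜 = Cardinal.continuum ∧
      IsMaxAntichainRel (Cord S) 𝒜) :=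
  ⟨CSaux_part_one S, CSaux_part_two S⟩
end

section
/- Let ⟨D,<⟩ be a countable random poset. Then the partial order ⟨ℙ(D), ⊆⟩ of copies of D contains a countably infinite maximal antichain. -/
/-- The extension property characterizing the countable random poset. -/
def RandomExt (α : Type*) [Preorder α] : Prop :=
  ∀ Lf Gf Uf : Finset α,
    (∀ x ∈ Lf, x ∉ Gf) → (∀ x ∈ Lf, x ∉ Uf) → (∀ x ∈ Gf, x ∉ Uf) →
    (∀ l ∈ Lf, ∀ g ∈ Gf, l < g) →
    (∀ u ∈ Uf, ∀ l ∈ Lf, ¬ u < l) →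
    (∀ u ∈ Uf, ∀ g ∈ Gf, ¬ g < u) →
    ∃ p, p ∉ Lf ∧ p ∉ Gf ∧ p ∉ Uf ∧
      (∀ l ∈ Lf, l < p) ∧ (∀ g ∈ Gf, p < g) ∧
      (∀ u ∈ Uf, ¬ p < u ∧ ¬ u < p)

/-- `A` is a copy of the poset `X`: `⟨A,<⟩` is order-isomorphic to `⟨X,<⟩`. -/
def IsCopyO {X : Type*} [PartialOrder X] (A : Set X) : Prop :=
  Nonempty (A ≃o X)

/-- Two copies are compatible if some copy is contained in both. -/
def CompatO {X : Type*} [PartialOrder X] (A B : Set X) : Prop :=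
  ∃ C : Set X, IsCopyO C ∧ C ⊆ A ∧ C ⊆ B

/-- A maximal antichain in the poset of copies of `X`. -/
def IsMaxAntichainO {X : Type*} [PartialOrder X] (𝒜 : Set (Set X)) : Prop :=
  (∀ A ∈ 𝒜, IsCopyO A) ∧
  (∀ A ∈ 𝒜, ∀ B ∈ 𝒜, A ≠ B → ¬ CompatO A B) ∧
  (∀ Z : Set X, IsCopyO Z → ∃ A ∈ 𝒜, CompatO Z A)

namespace RPoset

/-- A tidy form of the extension property, relative to a subset. -/
def ExtS {X : Type*} [PartialOrder X] (S : Set X) : Prop :=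
  ∀ L G U : Set X, L.Finite → G.Finite → U.Finite → L ⊆ S → G ⊆ S → U ⊆ S →
    (∀ l ∈ L, ∀ g ∈ G, l < g) → (∀ u ∈ U, ∀ l ∈ L, ¬ u ≤ l) → (∀ u ∈ U, ∀ g ∈ G, ¬ g ≤ u) →
    ∃ p ∈ S, (∀ l ∈ L, l < p) ∧ (∀ g ∈ G, p < g) ∧ (∀ u ∈ U, ¬ p ≤ u ∧ ¬ u ≤ p)

theorem extS_univ {X : Type*} [PartialOrder X] (h : RandomExt X) :
    ExtS (Set.univ : Set X) := by
  intro L G U hL hG hU _ _ _ h1 h2 h3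
  obtain ⟨p, -, -, hp3, hp4, hp5, hp6⟩ := h hL.toFinset hG.toFinset hU.toFinset
    (by
      simp only [Set.Finite.mem_toFinset]
      intro x hx hx'
      exact lt_irrefl _ (h1 x hx x hx'))
    (by
      simp only [Set.Finite.mem_toFinset]
      intro x hx hx'
      exact h2 x hx' x hx le_rfl)
    (by
      simp only [Set.Finite.mem_toFinset]
      intro x hx hx'
      exact h3 x hx' x hx le_rfl)
    (by simpa only [Set.Finite.mem_toFinset] using h1)
    (by
      simp only [Set.Finite.mem_toFinset]
      intro u hu l hl hlt
      exact h2 u hu l hl hlt.le)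
    (by
      simp only [Set.Finite.mem_toFinset]
      intro u hu l hl hlt
      exact h3 u hu l hl hlt.le)
  simp only [Set.Finite.mem_toFinset] at hp3 hp4 hp5 hp6
  refine ⟨p, trivial, hp4, hp5, fun u hu => ⟨fun hle => ?_, fun hle => ?_⟩⟩
  · rcases hle.eq_or_lt with rfl | hlt
    · exact hp3 hu
    · exact (hp6 u hu).1 hlt
  · rcases hle.eq_or_lt with rfl | hlt
    · exact hp3 hu
    · exact (hp6 u hu).2 hlt

theorem extS_of_iso {X Y : Type*} [PartialOrder X] [PartialOrder Y] {S : Set X}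
    (e : S ≃o Y) (h : ExtS (Set.univ : Set Y)) : ExtS S := by
  intro L G U hL hG hU hLS hGS hUS h1 h2 h3
  have hinj : Function.Injective (fun d : Y => (e.symm d).1) :=
    Subtype.val_injective.comp e.symm.injective
  have hle : ∀ a b : Y, (e.symm a).1 ≤ (e.symm b).1 ↔ a ≤ b := fun a b => by
    rw [Subtype.coe_le_coe]; exact e.symm.le_iff_le
  have hlt : ∀ a b : Y, (e.symm a).1 < (e.symm b).1 ↔ a < b := fun a b => by
    rw [Subtype.coe_lt_coe]; exact e.symm.lt_iff_lt
  have hsurj : ∀ x ∈ S, ∃ d : Y, (e.symm d).1 = x := fun x hx => ⟨e ⟨x, hx⟩, by simp⟩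
  obtain ⟨p, -, p1, p2, p3⟩ := h ((fun d : Y => (e.symm d).1) ⁻¹' L)
    ((fun d : Y => (e.symm d).1) ⁻¹' G) ((fun d : Y => (e.symm d).1) ⁻¹' U)
    (hL.preimage hinj.injOn) (hG.preimage hinj.injOn) (hU.preimage hinj.injOn)
    (Set.subset_univ _) (Set.subset_univ _) (Set.subset_univ _)
    (fun l hl g hg => (hlt _ _).1 (h1 _ hl _ hg))
    (fun u hu l hl hul => h2 _ hu _ hl ((hle _ _).2 hul))
    (fun u hu l hl hul => h3 _ hu _ hl ((hle _ _).2 hul))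
  refine ⟨(e.symm p).1, (e.symm p).2, ?_, ?_, ?_⟩
  · intro l hl
    obtain ⟨d, rfl⟩ := hsurj l (hLS hl)
    exact (hlt _ _).2 (p1 d hl)
  · intro l hl
    obtain ⟨d, rfl⟩ := hsurj l (hGS hl)
    exact (hlt _ _).2 (p2 d hl)
  · intro l hl
    obtain ⟨d, rfl⟩ := hsurj l (hUS hl)
    rw [hle, hle]
    exact p3 d hl

theorem extS_subtype {X : Type*} [PartialOrder X] {S : Set X} (h : ExtS S) :
    ExtS (Set.univ : Set S) := by
  intro L G U hL hG hU _ _ _ h1 h2 h3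
  obtain ⟨p, pS, p1, p2, p3⟩ := h (Subtype.val '' L) (Subtype.val '' G) (Subtype.val '' U)
    (hL.image _) (hG.image _) (hU.image _) (by simp) (by simp) (by simp)
    (by rintro _ ⟨l, hl, rfl⟩ _ ⟨g, hg, rfl⟩; exact h1 l hl g hg)
    (by rintro _ ⟨l, hl, rfl⟩ _ ⟨g, hg, rfl⟩; exact h2 l hl g hg)
    (by rintro _ ⟨l, hl, rfl⟩ _ ⟨g, hg, rfl⟩; exact h3 l hl g hg)
  exact ⟨⟨p, pS⟩, trivial, fun l hl => p1 l ⟨l, hl, rfl⟩, fun l hl => p2 l ⟨l, hl, rfl⟩,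
    fun l hl => p3 l ⟨l, hl, rfl⟩⟩

/-! ### Back and forth -/

/-- Finite partial isomorphisms. -/
def PIso (α β : Type*) [PartialOrder α] [PartialOrder β] : Type _ :=
  {f : Finset (α × β) // ∀ p ∈ f, ∀ q ∈ f, p.1 ≤ q.1 ↔ p.2 ≤ q.2}

instance instPIso (α β : Type*) [PartialOrder α] [PartialOrder β] : Preorder (PIso α β) :=
  Subtype.preorder _

theorem step {α β : Type*} [PartialOrder α] [PartialOrder β]
    (hβ : ExtS (Set.univ : Set β)) (f : PIso α β) (a : α) :
    ∃ g : PIso α β, (∃ b, (a, b) ∈ g.1) ∧ f ≤ g := by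
  classical
  by_cases ha : ∃ b, (a, b) ∈ f.1
  · exact ⟨f, ha, le_rfl⟩
  have hf := f.2
  have fin : ∀ P : α × β → Prop, {b | ∃ p ∈ f.1, P p ∧ p.2 = b}.Finite := fun P => by
    refine (f.1.finite_toSet.image Prod.snd).subset ?_
    rintro b ⟨p, hp, -, rfl⟩
    exact ⟨p, hp, rfl⟩
  obtain ⟨b, -, b1, b2, b3⟩ := hβ {b | ∃ p ∈ f.1, p.1 < a ∧ p.2 = b}
    {b | ∃ p ∈ f.1, a < p.1 ∧ p.2 = b} {b | ∃ p ∈ f.1, (¬ p.1 ≤ a ∧ ¬ a ≤ p.1) ∧ p.2 = b}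
    (fin _) (fin _) (fin _)
    (Set.subset_univ _) (Set.subset_univ _) (Set.subset_univ _)
    (by
      rintro _ ⟨p, hp, hpa, rfl⟩ _ ⟨q, hq, hqa, rfl⟩
      have := hpa.trans hqa
      rw [lt_iff_le_not_ge] at this ⊢
      rwa [← hf p hp q hq, ← hf q hq p hp])
    (by
      rintro _ ⟨p, hp, hpa, rfl⟩ _ ⟨q, hq, hqa, rfl⟩ hle
      rw [← hf p hp q hq] at hle
      exact hpa.1 (hle.trans hqa.le))
    (by
      rintro _ ⟨p, hp, hpa, rfl⟩ _ ⟨q, hq, hqa, rfl⟩ hle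
      rw [← hf q hq p hp] at hle
      exact hpa.2 (hqa.le.trans hle))
  have key : ∀ p ∈ f.1, (p.1 ≤ a ↔ p.2 ≤ b) ∧ (a ≤ p.1 ↔ b ≤ p.2) := by
    intro p hp
    have hne : p.1 ≠ a := by
      rintro rfl
      exact ha ⟨p.2, hp⟩
    by_cases h1 : p.1 ≤ a
    · have hlt := lt_of_le_of_ne h1 hne
      have := b1 p.2 ⟨p, hp, hlt, rfl⟩
      simp [h1, this.le, hlt.not_ge, this.not_ge]
    · by_cases h2 : a ≤ p.1
      · have hlt := lt_of_le_of_ne h2 hne.symm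
        have := b2 p.2 ⟨p, hp, hlt, rfl⟩
        simp [h2, this.le, hlt.not_ge, this.not_ge]
      · have := b3 p.2 ⟨p, hp, ⟨h1, h2⟩, rfl⟩
        simp [h1, h2, this.1, this.2]
  refine ⟨⟨insert (a, b) f.1, ?_⟩, ⟨b, Finset.mem_insert_self _ _⟩, Finset.subset_insert _ _⟩
  intro p hp q hq
  rcases Finset.mem_insert.1 hp with rfl | hp <;> rcases Finset.mem_insert.1 hq with rfl | hq
  · simp
  · exact (key q hq).2
  · exact (key p hp).1
  · exact hf p hp q hq

/-- Swap a partial isomorphism. -/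
def PIso.swap {α β : Type*} [PartialOrder α] [PartialOrder β] (f : PIso α β) : PIso β α :=
  ⟨f.1.map (Equiv.prodComm α β).toEmbedding, by
    intro p hp q hq
    simp only [Finset.mem_map_equiv] at hp hq
    exact (f.2 _ hp _ hq).symm⟩

theorem step' {α β : Type*} [PartialOrder α] [PartialOrder β]
    (hα : ExtS (Set.univ : Set α)) (f : PIso α β) (b : β) :
    ∃ g : PIso α β, (∃ a, (a, b) ∈ g.1) ∧ f ≤ g := by
  obtain ⟨g, ⟨a, ha⟩, hg⟩ := step hα f.swap b
  refine ⟨g.swap, ⟨a, ?_⟩, ?_⟩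
  · exact Finset.mem_map_equiv.2 ha
  · intro p hp
    exact Finset.mem_map_equiv.2 (hg (Finset.mem_map_equiv.2 hp))

theorem backforth {α β : Type*} [PartialOrder α] [PartialOrder β] [Countable α] [Countable β]
    (hα : ExtS (Set.univ : Set α)) (hβ : ExtS (Set.univ : Set β)) : Nonempty (α ≃o β) := by
  cases nonempty_encodable α
  cases nonempty_encodable β
  let C : α ⊕ β → Order.Cofinal (PIso α β) := fun p =>
    Sum.recOn p
      (fun a => ⟨{g | ∃ b, (a, b) ∈ g.1}, fun f => step hβ f a⟩)
      (fun b => ⟨{g | ∃ a, (a, b) ∈ g.1}, fun f => step' hα f b⟩)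
  let f0 : PIso α β := ⟨∅, by simp⟩
  let I : Order.Ideal (PIso α β) := Order.idealOfCofinals f0 C
  have hA : ∀ a : α, ∃ b : β, ∃ f ∈ I, (a, b) ∈ f.1 := fun a => by
    obtain ⟨f, ⟨b, hb⟩, hf⟩ := Order.cofinal_meets_idealOfCofinals f0 C (Sum.inl a)
    exact ⟨b, f, hf, hb⟩
  have hB : ∀ b : β, ∃ a : α, ∃ f ∈ I, (a, b) ∈ f.1 := fun b => by
    obtain ⟨f, ⟨a, ha⟩, hf⟩ := Order.cofinal_meets_idealOfCofinals f0 C (Sum.inr b)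
    exact ⟨a, f, hf, ha⟩
  have hI : ∀ a b a' b', (∃ f ∈ I, (a, b) ∈ f.1) → (∃ f ∈ I, (a', b') ∈ f.1) →
      (a ≤ a' ↔ b ≤ b') := by
    rintro a b a' b' ⟨f, hf, hab⟩ ⟨g, hg, hab'⟩
    obtain ⟨m, -, fm, gm⟩ := I.directed _ hf _ hg
    exact m.2 _ (fm hab) _ (gm hab')
  choose F hF using hA
  choose G hG using hB
  exact ⟨{
    toFun := F
    invFun := G
    left_inv := fun a => le_antisymm
      ((hI _ _ _ _ (hG (F a)) (hF a)).2 le_rfl) ((hI _ _ _ _ (hF a) (hG (F a))).2 le_rfl)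
    right_inv := fun b => le_antisymm
      ((hI _ _ _ _ (hF (G b)) (hG b)).1 le_rfl) ((hI _ _ _ _ (hG b) (hF (G b))).1 le_rfl)
    map_rel_iff' := fun {a b} => (hI _ _ _ _ (hF a) (hF b)).symm }⟩

/-! ### Indivisibility -/

section
variable {X : Type*} [PartialOrder X]

theorem ExtS.nonempty {S : Set X} (h : ExtS S) : S.Nonempty := by
  obtain ⟨p, hp, -⟩ := h ∅ ∅ ∅ (by simp) (by simp) (by simp) (by simp) (by simp) (by simp)
    (by simp) (by simp) (by simp)
  exact ⟨p, hp⟩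

/-- The set of realizers of a type over an `ExtS` set is `ExtS`. -/
theorem ExtS.realizers {S : Set X} (h : ExtS S) (L G U : Set X) (hL : L.Finite) (hG : G.Finite)
    (hU : U.Finite) (hLS : L ⊆ S) (hGS : G ⊆ S) (hUS : U ⊆ S)
    (h1 : ∀ l ∈ L, ∀ g ∈ G, l < g) (h2 : ∀ u ∈ U, ∀ l ∈ L, ¬ u ≤ l)
    (h3 : ∀ u ∈ U, ∀ g ∈ G, ¬ g ≤ u) :
    ExtS {p | p ∈ S ∧ (∀ l ∈ L, l < p) ∧ (∀ g ∈ G, p < g) ∧ (∀ u ∈ U, ¬ p ≤ u ∧ ¬ u ≤ p)} := by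
  intro L' G' U' hL' hG' hU' hLS' hGS' hUS' h1' h2' h3'
  obtain ⟨p, hp, p1, p2, p3⟩ := h (L ∪ L') (G ∪ G') (U ∪ U') (hL.union hL') (hG.union hG')
    (hU.union hU')
    (Set.union_subset hLS fun x hx => (hLS' hx).1) (Set.union_subset hGS fun x hx => (hGS' hx).1)
    (Set.union_subset hUS fun x hx => (hUS' hx).1)
    (by
      rintro l (hl | hl) g (hg | hg)
      · exact h1 l hl g hg
      · exact (hGS' hg).2.1 l hl
      · exact (hLS' hl).2.2.1 g hg
      · exact h1' l hl g hg)
    (by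
      rintro u (hu | hu) l (hl | hl)
      · exact h2 u hu l hl
      · exact ((hLS' hl).2.2.2 u hu).2
      · exact ((hUS' hu).2.1 l hl).not_ge
      · exact h2' u hu l hl)
    (by
      rintro u (hu | hu) l (hl | hl)
      · exact h3 u hu l hl
      · exact ((hGS' hl).2.2.2 u hu).1
      · exact ((hUS' hu).2.2.1 l hl).not_ge
      · exact h3' u hu l hl)
  exact ⟨p, ⟨hp, fun l hl => p1 l (Or.inl hl), fun l hl => p2 l (Or.inl hl),
    fun l hl => p3 l (Or.inl hl)⟩, fun l hl => p1 l (Or.inr hl), fun l hl => p2 l (Or.inr hl),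
    fun l hl => p3 l (Or.inr hl)⟩

theorem ExtS.split {S : Set X} (h : ExtS S) (P : Set X) :
    ExtS (S ∩ P) ∨ ∃ T, ExtS T ∧ T ⊆ S \ P := by
  by_contra! hc
  obtain ⟨hc1, hc2⟩ := hc
  apply hc1
  intro L G U hL hG hU hLS hGS hUS h1 h2 h3
  by_contra hn
  refine hc2 _ (h.realizers L G U hL hG hU (fun x hx => (hLS hx).1) (fun x hx => (hGS hx).1)
    (fun x hx => (hUS hx).1) h1 h2 h3) ?_
  rintro p ⟨hp, hp'⟩
  exact ⟨hp, fun hpP => hn ⟨p, ⟨hp, hpP⟩, hp'⟩⟩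

theorem ExtS.not_subsingleton {S : Set X} (h : ExtS S) (x : X) : ¬ S ⊆ {x} := by
  intro hs
  obtain ⟨y, hy⟩ := h.nonempty
  obtain rfl : y = x := hs hy
  obtain ⟨z, hz, -, -, hz'⟩ := h ∅ ∅ {y} (by simp) (by simp) (by simp) (by simp) (by simp)
    (by simpa using hy) (by simp) (by simp) (by simp)
  obtain rfl : z = y := hs hz
  exact (hz' z rfl).1 le_rfl

theorem ExtS.finite_split (A : ℕ → Set X) (n : ℕ) : ∀ {S : Set X}, ExtS S →
    (∀ x ∈ S, ∃ i < n, x ∈ A i) → ∃ i < n, ∃ T, ExtS T ∧ T ⊆ S ∧ T ⊆ A i := by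
  induction n with
  | zero =>
    intro S h hS
    obtain ⟨x, hx⟩ := h.nonempty
    obtain ⟨i, hi, -⟩ := hS x hx
    omega
  | succ n ih =>
    intro S h hS
    rcases h.split (A n) with h' | ⟨T, hT, hTS⟩
    · exact ⟨n, by omega, _, h', Set.inter_subset_left, Set.inter_subset_right⟩
    · obtain ⟨i, hi, T', h1, h2, h3⟩ := ih hT (fun x hx => by
        obtain ⟨i, hi, hxi⟩ := hS x (hTS hx).1
        refine ⟨i, ?_, hxi⟩
        rcases Nat.lt_succ_iff_lt_or_eq.1 hi with h | rfl
        · exact h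
        · exact absurd hxi (hTS hx).2)
      exact ⟨i, by omega, T', h1, fun x hx => (hTS (h2 hx)).1, h3⟩

/-- The pieces of the antichain. -/
def piece (v : ℕ → X) (n : ℕ) : Set X := {x | v n < x ∧ ∀ i < n, ¬ v i ≤ x}

theorem piece_ext (h : ExtS (Set.univ : Set X)) (v : ℕ → X) (n : ℕ)
    (hn : ∀ i < n, ¬ v i ≤ v n) : ExtS (piece v n) := by
  intro L G U hL hG hU hLS hGS hUS h1 h2 h3
  obtain ⟨p, -, p1, p2, p3⟩ := h (insert (v n) L) G
    (U ∪ {y | y ∈ v '' Set.Iio n ∧ ∀ g ∈ G, ¬ g ≤ y}) (hL.insert _) hG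
    (hU.union (((Set.finite_Iio n).image v).subset fun y hy => hy.1))
    (Set.subset_univ _) (Set.subset_univ _) (Set.subset_univ _)
    (by
      rintro l (rfl | hl) g hg
      · exact (hGS hg).1
      · exact h1 l hl g hg)
    (by
      rintro u (hu | ⟨⟨i, hi, rfl⟩, -⟩) l (rfl | hl)
      · exact (hUS hu).1.not_ge
      · exact h2 u hu l hl
      · exact hn i hi
      · exact (hLS hl).2 i hi)
    (by
      rintro u (hu | ⟨-, hu⟩) g hg
      · exact h3 u hu g hg
      · exact hu g hg)
  refine ⟨p, ⟨p1 _ (Or.inl rfl), fun i hi hip => ?_⟩, fun l hl => p1 l (Or.inr hl), p2,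
    fun u hu => p3 u (Or.inl hu)⟩
  by_cases hg : ∀ g ∈ G, ¬ g ≤ v i
  · exact (p3 (v i) (Or.inr ⟨⟨i, hi, rfl⟩, hg⟩)).2 hip
  · push Not at hg
    obtain ⟨g, hg, hgi⟩ := hg
    exact (hGS hg).2 i hi (hip.trans (p2 g hg).le)

theorem piece_disj (v : ℕ → X) {m n : ℕ} {x : X} (hm : x ∈ piece v m) (hn : x ∈ piece v n) :
    m = n := by
  rcases lt_trichotomy m n with h | h | h
  · exact absurd hm.1.le (hn.2 m h)
  · exact h
  · exact absurd hn.1.le (hm.2 n h)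

end

end RPoset

open RPoset in
theorem random_poset_countable_max_antichain (D : Type) [PartialOrder D]
    [Countable D] [Infinite D] (hD : RandomExt D) :
    ∃ 𝒜 : Set (Set D), 𝒜.Countable ∧ 𝒜.Infinite ∧ IsMaxAntichainO 𝒜 := by
  have hE := extS_univ hD
  have toCopy : ∀ S : Set D, ExtS S → IsCopyO S := fun S hS => backforth (extS_subtype hS) hE
  have ofCopy : ∀ S : Set D, IsCopyO S → ExtS S := fun S ⟨e⟩ => extS_of_iso e hE
  obtain ⟨v, hv⟩ := exists_surjective_nat D
  let N : Set ℕ := {n | ∀ i < n, ¬ v i ≤ v n}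
  have hN : N.Infinite := by
    intro hfin
    obtain ⟨p, -, -, -, hp⟩ := hE ∅ ∅ (v '' N) (by simp) (by simp) (hfin.image v) (by simp)
      (by simp) (by simp) (by simp) (by simp) (by simp)
    obtain ⟨k, rfl⟩ := hv p
    -- least index below p
    classical
    have hex : ∃ i, v i ≤ v k := ⟨k, le_rfl⟩
    have hmem : Nat.find hex ∈ N := fun i hi hle =>
      Nat.find_min hex hi (hle.trans (Nat.find_spec hex))
    exact (hp _ ⟨_, hmem, rfl⟩).2 (Nat.find_spec hex)
  refine ⟨piece v '' N, (Set.to_countable N).image _, ?_, ?_, ?_, ?_⟩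
  · refine hN.image ?_
    intro m hm n hn hmn
    obtain ⟨x, hx⟩ := (piece_ext hE v m hm).nonempty
    have hx' : x ∈ piece v n := by
      have hmn' : piece v m = piece v n := hmn
      rwa [← hmn']
    exact piece_disj v hx hx'
  · rintro _ ⟨n, hn, rfl⟩
    exact toCopy _ (piece_ext hE v n hn)
  · rintro _ ⟨m, hm, rfl⟩ _ ⟨n, hn, rfl⟩ hne ⟨C, hC, h1, h2⟩
    obtain ⟨x, hx⟩ := (ofCopy C hC).nonempty
    exact hne (by rw [piece_disj v (h1 hx) (h2 hx)])
  · intro Z hZ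
    have hZE := ofCopy Z hZ
    obtain ⟨z, hz⟩ := hZE.nonempty
    obtain ⟨n, rfl⟩ := hv z
    have hR := hZE.realizers {v n} ∅ ∅ (by simp) (by simp) (by simp) (by simpa using hz) (by simp)
      (by simp) (by simp) (by simp) (by simp)
    obtain ⟨i, hi, T, hT, hTR, hTi⟩ := ExtS.finite_split (fun i => piece v i ∪ {v i}) (n + 1) hR (by
      rintro x ⟨-, hx, -⟩
      classical
      have hex : ∃ i, v i ≤ x := ⟨n, (hx _ rfl).le⟩
      refine ⟨Nat.find hex, Nat.lt_succ_of_le (Nat.find_min' hex (hx _ rfl).le), ?_⟩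
      rcases (Nat.find_spec hex).eq_or_lt with h | h
      · exact Or.inr h.symm
      · exact Or.inl ⟨h, fun j hj => Nat.find_min hex hj⟩)
    have hfin : ∃ T', ExtS T' ∧ T' ⊆ T ∧ T' ⊆ piece v i := by
      rcases hT.split (piece v i) with h | ⟨T', hT', hs⟩
      · exact ⟨_, h, Set.inter_subset_left, Set.inter_subset_right⟩
      · refine absurd ?_ (hT'.not_subsingleton (v i))
        intro x hx
        exact (hTi (hs hx).1).resolve_left (hs hx).2
    obtain ⟨T', hT', hs, hsi⟩ := hfin
    refine ⟨piece v i, ⟨i, ?_, rfl⟩, T', toCopy _ hT', fun x hx => (hTR (hs hx)).1, hsi⟩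
    obtain ⟨x, hx⟩ := hT'.nonempty
    intro j hj hle
    exact (hsi hx).2 j hj (hle.trans (hsi hx).1.le)
end

section
/- Let ⟨D,<⟩ be a countable random poset. Then the partial order ⟨ℙ(D), ⊆⟩ of copies of D contains a maximal antichain of cardinality 2^ℵ₀. -/
theorem exists_inj_choice {ι D : Type} [Countable ι] (S : ι → Set D)
    (hS : ∀ i, (S i).Infinite) : ∃ x : ι → D, Function.Injective x ∧ ∀ i, x i ∈ S i := by
  classical
  have : Encodable ι := Encodable.ofCountable ι
  have h : ∀ i, ∃ t : Finset D, (t : Set D) ⊆ S i ∧ t.card = Encodable.encode i + 1 :=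
    fun i => (hS i).exists_subset_card_eq _
  choose t ht hc using h
  have hall := (Finset.all_card_le_biUnion_card_iff_exists_injective t).1 (by
    intro s
    rcases s.eq_empty_or_nonempty with rfl | hne
    · simp
    · obtain ⟨i, hi, hmax⟩ := s.exists_max_image (fun i => Encodable.encode i) hne
      have h1 : s.card ≤ (Finset.range (Encodable.encode i + 1)).card := by
        apply Finset.card_le_card_of_injOn (fun i => Encodable.encode i)
        · intro j hj
          have := hmax j hj
          simp
          omega
        · intro a _ b _ hab
          exact Encodable.encode_injective hab
      rw [Finset.card_range, ← hc i] at h1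
      exact h1.trans (Finset.card_le_card (Finset.subset_biUnion_of_mem t hi)))
  obtain ⟨f, hf, hm⟩ := hall
  exact ⟨f, hf, fun i => ht i (hm i)⟩

/-- The side conditions of the extension property. -/
def ValidT {D : Type} [PartialOrder D] (L G U : Finset D) : Prop :=
  (∀ x ∈ L, x ∉ G) ∧ (∀ x ∈ L, x ∉ U) ∧ (∀ x ∈ G, x ∉ U) ∧
    (∀ l ∈ L, ∀ g ∈ G, l < g) ∧
    (∀ u ∈ U, ∀ l ∈ L, ¬ u < l) ∧
    (∀ u ∈ U, ∀ g ∈ G, ¬ g < u)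

/-- The witnesses of the extension property. -/
def WitT {D : Type} [PartialOrder D] (L G U : Finset D) : Set D :=
  {p | p ∉ L ∧ p ∉ G ∧ p ∉ U ∧
      (∀ l ∈ L, l < p) ∧ (∀ g ∈ G, p < g) ∧
      (∀ u ∈ U, ¬ p < u ∧ ¬ u < p)}

theorem witT_infinite {D : Type} [PartialOrder D] (hD : RandomExt D) (L G U : Finset D)
    (h : ValidT L G U) : (WitT L G U).Infinite := by
  classical
  intro hfin
  obtain ⟨h1, h2, h3, h4, h5, h6⟩ := h
  have hne : (WitT L G U).Nonempty := hD L G U h1 h2 h3 h4 h5 h6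
  obtain ⟨p, hp⟩ := hfin.exists_maximal hne
  obtain ⟨⟨q1, q2, q3, q4, q5, q6⟩, hmax⟩ := hp
  obtain ⟨r, r1, r2, r3, r4, r5, r6⟩ := hD (insert p L) G U
    (by simpa using ⟨q2, h1⟩) (by simpa using ⟨q3, h2⟩) h3
    (by simpa using ⟨q5, h4⟩)
    (by
      intro u hu l hl
      rcases Finset.mem_insert.1 hl with rfl | hl
      · exact (q6 u hu).2
      · exact h5 u hu l hl) h6
  have hr : r ∈ WitT L G U :=
    ⟨fun hh => r1 (Finset.mem_insert_of_mem hh), r2, r3,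
      fun l hl => r4 l (Finset.mem_insert_of_mem hl), r5, r6⟩
  have hlt := r4 p (Finset.mem_insert_self _ _)
  exact absurd (hmax hr hlt.le) (not_le_of_gt hlt)

theorem exists_ad {D : Type} [PartialOrder D] [Countable D] [Infinite D] (hD : RandomExt D) :
    ∃ e : Set ℕ → D → D, (∀ S a b, e S a ≤ e S b ↔ a ≤ b) ∧
      ∀ S T, S ≠ T → (Set.range (e S) ∩ Set.range (e T)).Finite := by
  classical
  obtain ⟨x, hxi, hx⟩ := exists_inj_choice
    (ι := (Finset D × Finset D × Finset D) × (ℕ × Finset ℕ))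
    (fun i => {p | ValidT i.1.1 i.1.2.1 i.1.2.2 → p ∈ WitT i.1.1 i.1.2.1 i.1.2.2}) (by
      intro i
      by_cases h : ValidT i.1.1 i.1.2.1 i.1.2.2
      · simpa [h] using witT_infinite hD _ _ _ h
      · simpa [h] using Set.infinite_univ)
  obtain ⟨dd⟩ := nonempty_denumerable D
  let d : ℕ ≃ D := (Denumerable.eqv D).symm
  let step : Set ℕ → (n : ℕ) → ((m : ℕ) → m < n → D) → D := fun S n ih =>
    x ((Finset.univ.image (fun k : {k : Fin n // d k < d n} => ih k.1 k.1.2),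
        Finset.univ.image (fun k : {k : Fin n // d n < d k} => ih k.1 k.1.2),
        Finset.univ.image (fun k : {k : Fin n // ¬ d k < d n ∧ ¬ d n < d k} => ih k.1 k.1.2)),
       (n, (Finset.range n).filter (· ∈ S)))
  let E : Set ℕ → ℕ → D := fun S n => Nat.strongRec (motive := fun _ => D) (step S) n
  have hE : ∀ S n, ∃ L G U : Finset D,
      (∀ y, y ∈ L ↔ ∃ k < n, d k < d n ∧ E S k = y) ∧
      (∀ y, y ∈ G ↔ ∃ k < n, d n < d k ∧ E S k = y) ∧
      (∀ y, y ∈ U ↔ ∃ k < n, (¬ d k < d n ∧ ¬ d n < d k) ∧ E S k = y) ∧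
      E S n = x ((L, G, U), (n, (Finset.range n).filter (· ∈ S))) := by
    intro S n
    refine ⟨Finset.univ.image (fun k : {k : Fin n // d k < d n} => E S k.1),
        Finset.univ.image (fun k : {k : Fin n // d n < d k} => E S k.1),
        Finset.univ.image (fun k : {k : Fin n // ¬ d k < d n ∧ ¬ d n < d k} => E S k.1),
        ?_, ?_, ?_, ?_⟩
    · intro y
      constructor
      · intro h
        obtain ⟨⟨k, hk⟩, -, rfl⟩ := Finset.mem_image.1 h
        exact ⟨k, k.2, hk, rfl⟩
      · rintro ⟨k, hk, h, rfl⟩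
        exact Finset.mem_image.2 ⟨⟨⟨k, hk⟩, h⟩, Finset.mem_univ _, rfl⟩
    · intro y
      constructor
      · intro h
        obtain ⟨⟨k, hk⟩, -, rfl⟩ := Finset.mem_image.1 h
        exact ⟨k, k.2, hk, rfl⟩
      · rintro ⟨k, hk, h, rfl⟩
        exact Finset.mem_image.2 ⟨⟨⟨k, hk⟩, h⟩, Finset.mem_univ _, rfl⟩
    · intro y
      constructor
      · intro h
        obtain ⟨⟨k, hk⟩, -, rfl⟩ := Finset.mem_image.1 h
        exact ⟨k, k.2, hk, rfl⟩
      · rintro ⟨k, hk, h, rfl⟩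
        exact Finset.mem_image.2 ⟨⟨⟨k, hk⟩, h⟩, Finset.mem_univ _, rfl⟩
    · change Nat.strongRec (motive := fun _ => D) (step S) n = _
      rw [Nat.strongRec]
  have hlab : ∀ S T n m, E S n = E T m →
      n = m ∧ (Finset.range n).filter (· ∈ S) = (Finset.range m).filter (· ∈ T) := by
    intro S T n m h
    obtain ⟨L, G, U, -, -, -, h1⟩ := hE S n
    obtain ⟨L', G', U', -, -, -, h2⟩ := hE T m
    rw [h1, h2] at h
    have := hxi h
    simp only [Prod.mk.injEq] at this
    exact this.2
  clear_value E
  have hinj : ∀ S n m, E S n = E S m → n = m := fun S n m h => (hlab S S n m h).1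
  have hlt : ∀ S n, ∀ k < n, ∀ m < n, (E S k < E S m ↔ d k < d m) := by
    intro S n
    induction n with
    | zero => intro k hk; omega
    | succ n ih =>
      obtain ⟨L, G, U, hL, hG, hU, h1⟩ := hE S n
      have hv : ValidT L G U := by
        refine ⟨?_, ?_, ?_, ?_, ?_, ?_⟩
        · intro y hl hg
          obtain ⟨k, hk, hd, rfl⟩ := (hL y).1 hl
          obtain ⟨m, hm, hd', he⟩ := (hG _).1 hg
          obtain rfl := hinj _ _ _ he
          exact lt_asymm hd hd'
        · intro y hl hg
          obtain ⟨k, hk, hd, rfl⟩ := (hL y).1 hl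
          obtain ⟨m, hm, hd', he⟩ := (hU _).1 hg
          obtain rfl := hinj _ _ _ he
          exact hd'.1 hd
        · intro y hl hg
          obtain ⟨k, hk, hd, rfl⟩ := (hG y).1 hl
          obtain ⟨m, hm, hd', he⟩ := (hU _).1 hg
          obtain rfl := hinj _ _ _ he
          exact hd'.2 hd
        · intro y hl z hg
          obtain ⟨k, hk, hd, rfl⟩ := (hL y).1 hl
          obtain ⟨m, hm, hd', rfl⟩ := (hG _).1 hg
          exact (ih k hk m hm).2 (hd.trans hd')
        · intro y hl z hg
          obtain ⟨k, hk, hd, rfl⟩ := (hU y).1 hl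
          obtain ⟨m, hm, hd', rfl⟩ := (hL _).1 hg
          rw [ih k hk m hm]
          exact fun h => hd.1 (h.trans hd')
        · intro y hl z hg
          obtain ⟨k, hk, hd, rfl⟩ := (hU y).1 hl
          obtain ⟨m, hm, hd', rfl⟩ := (hG _).1 hg
          rw [ih m hm k hk]
          exact fun h => hd.2 (hd'.trans h)
      have hw : E S n ∈ WitT L G U := by
        rw [h1]
        exact hx ((L, G, U), (n, (Finset.range n).filter (· ∈ S))) hv
      obtain ⟨-, -, -, w1, w2, w3⟩ := hw
      have key : ∀ k < n, (E S k < E S n ↔ d k < d n) ∧ (E S n < E S k ↔ d n < d k) := by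
        intro k hk
        by_cases c1 : d k < d n
        · have := w1 _ ((hL _).2 ⟨k, hk, c1, rfl⟩)
          simp [c1, this, this.not_gt, c1.not_gt]
        · by_cases c2 : d n < d k
          · have := w2 _ ((hG _).2 ⟨k, hk, c2, rfl⟩)
            simp [c2, this, this.not_gt, c2.not_gt]
          · have := w3 _ ((hU _).2 ⟨k, hk, ⟨c1, c2⟩, rfl⟩)
            simp [c1, c2, this]
      intro k hk m hm
      rcases Nat.lt_succ_iff_lt_or_eq.1 hk with hk | rfl
      · rcases Nat.lt_succ_iff_lt_or_eq.1 hm with hm | rfl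
        · exact ih k hk m hm
        · exact (key k hk).1
      · rcases Nat.lt_succ_iff_lt_or_eq.1 hm with hm | rfl
        · exact (key m hm).2
        · simp
  have hlt' : ∀ S k m, (E S k < E S m ↔ d k < d m) := fun S k m =>
    hlt S (max k m + 1) k (by omega) m (by omega)
  refine ⟨fun S a => E S (d.symm a), ?_, ?_⟩
  · intro S a b
    have h := hlt' S (d.symm a) (d.symm b)
    simp only [Equiv.apply_symm_apply] at h
    rw [le_iff_lt_or_eq, le_iff_lt_or_eq, h]
    refine or_congr Iff.rfl ⟨fun h => d.symm.injective (hinj _ _ _ h), fun h => by rw [h]⟩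
  · intro S T hST
    obtain ⟨j, hj⟩ : ∃ j, ¬ (j ∈ S ↔ j ∈ T) := by
      by_contra! hh
      exact hST (Set.ext hh)
    refine ((Set.finite_Iic j).image (E S)).subset ?_
    rintro y ⟨⟨a, rfl⟩, ⟨b, hb⟩⟩
    refine ⟨d.symm a, ?_, rfl⟩
    obtain ⟨h1, h2⟩ := hlab _ _ _ _ hb
    by_contra hc
    have hc : j < d.symm a := by simpa using hc
    have := Finset.ext_iff.1 h2 j
    simp only [Finset.mem_filter, Finset.mem_range, h1, hc, true_and] at this
    exact hj this.symm

theorem random_poset_continuum_max_antichain (D : Type) [PartialOrder D]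
    [Countable D] [Infinite D] (hD : RandomExt D) :
    ∃ 𝒜 : Set (Set D), Cardinal.mk 𝒜 = Cardinal.continuum ∧ IsMaxAntichainO 𝒜 := by
  classical
  obtain ⟨e, he, hfin⟩ := exists_ad hD
  have hei : ∀ S, Function.Injective (e S) := fun S a b h =>
    le_antisymm ((he S a b).1 h.le) ((he S b a).1 h.ge)
  have hcopy : ∀ S, IsCopyO (Set.range (e S)) := fun S =>
    ⟨(OrderIso.symm ⟨Equiv.ofInjective (e S) (hei S), by
      intro a b
      exact he S a b⟩)⟩
  have hinf : ∀ C : Set D, IsCopyO C → C.Infinite := by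
    rintro C ⟨i⟩
    exact Set.infinite_coe_iff.1 (Infinite.of_injective i.symm i.symm.injective)
  let P : Set (Set (Set D)) := {𝒜 | (∀ A ∈ 𝒜, IsCopyO A) ∧
    (∀ A ∈ 𝒜, ∀ B ∈ 𝒜, A ≠ B → ¬ CompatO A B)}
  have h0 : Set.range (fun S => Set.range (e S)) ∈ P := by
    refine ⟨?_, ?_⟩
    · rintro _ ⟨S, rfl⟩
      exact hcopy S
    · rintro _ ⟨S, rfl⟩ _ ⟨T, rfl⟩ hne ⟨C, hC, h1, h2⟩
      have : S ≠ T := by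
        rintro rfl
        exact hne rfl
      exact hinf C hC ((hfin S T this).subset (Set.subset_inter h1 h2))
  obtain ⟨M, hM0, hM⟩ := zorn_subset_nonempty P (by
    intro c hc hch hne
    refine ⟨⋃₀ c, ⟨?_, ?_⟩, fun s hs => Set.subset_sUnion_of_mem hs⟩
    · rintro A ⟨s, hs, hA⟩
      exact (hc hs).1 A hA
    · rintro A ⟨s, hs, hA⟩ B ⟨t, ht, hB⟩
      rcases hch.total hs ht with h | h
      · exact (hc ht).2 A (h hA) B hB
      · exact (hc hs).2 A hA B (h hB)) _ h0
  refine ⟨M, le_antisymm ?_ ?_, hM.prop.1, hM.prop.2, ?_⟩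
  · refine (Cardinal.mk_set_le M).trans ?_
    rw [Cardinal.mk_set, Cardinal.mk_eq_aleph0, Cardinal.two_power_aleph0]
  · rw [← Cardinal.two_power_aleph0, ← Cardinal.mk_nat, ← Cardinal.mk_set]
    refine Cardinal.mk_le_of_injective
      (f := fun S : Set ℕ => (⟨Set.range (e S), hM0 ⟨S, rfl⟩⟩ : M)) ?_
    intro S T h
    have h : Set.range (e S) = Set.range (e T) := congrArg Subtype.val h
    by_contra hne
    have := hfin S T hne
    rw [← h, Set.inter_self] at this
    exact hinf _ (hcopy S) this
  · intro Z hZ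
    by_contra! hcon
    have hins : insert Z M ∈ P := by
      refine ⟨?_, ?_⟩
      · rintro A (rfl | hA)
        · exact hZ
        · exact hM.prop.1 A hA
      · rintro A (rfl | hA) B (rfl | hB) hne
        · exact absurd rfl hne
        · exact hcon B hB
        · rintro ⟨C, hC, h1, h2⟩
          exact hcon A hA ⟨C, hC, h2, h1⟩
        · exact hM.prop.2 A hA B hB hne
    have hZM : Z ∈ M := hM.le_of_ge hins (Set.subset_insert Z M) (Set.mem_insert Z M)
    exact hcon Z hZM ⟨Z, hZ, subset_rfl, subset_rfl⟩
end

section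
/- Let ⟨D,<⟩ be a countable random poset and let a, b ∈ D with a < b. Then the set X = {x ∈ D : x < b and ¬(x ≤ a)}, with the order induced from D, is again a countable random poset (hence order-isomorphic to D). -/
open Classical in
/-- One-point extension of a finite partial isomorphism into a random poset. -/
theorem RandomExt.across {α β : Type*} [PartialOrder α] [PartialOrder β] (hβ : RandomExt β)
    (f : Finset (α × β))
    (hf : ∀ p ∈ f, ∀ q ∈ f, p.1 ≤ q.1 ↔ p.2 ≤ q.2) (a : α) :
    ∃ b : β, ∀ p ∈ f, (p.1 ≤ a ↔ p.2 ≤ b) ∧ (a ≤ p.1 ↔ b ≤ p.2) := by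
  by_cases h : ∃ b, (a, b) ∈ f
  · obtain ⟨b, hb⟩ := h
    exact ⟨b, fun p hp => ⟨hf _ hp _ hb, hf _ hb _ hp⟩⟩
  have hlt : ∀ p ∈ f, ∀ q ∈ f, p.1 < q.1 ↔ p.2 < q.2 := fun p hp q hq => by
    rw [lt_iff_le_not_ge, lt_iff_le_not_ge, hf p hp q hq, hf q hq p hp]
  have heq : ∀ p ∈ f, ∀ q ∈ f, p.2 = q.2 → p.1 = q.1 := fun p hp q hq e =>
    le_antisymm ((hf p hp q hq).2 e.le) ((hf q hq p hp).2 e.ge)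
  have hne : ∀ p ∈ f, p.1 ≠ a := fun p hp e => h ⟨p.2, by rw [← e]; exact hp⟩
  obtain ⟨S, key⟩ : ∃ S : (α → Prop) → Finset β, ∀ P x, x ∈ S P ↔
      ∃ p ∈ f, P p.1 ∧ p.2 = x := by
    refine ⟨fun P => (f.filter (fun p => P p.1)).image Prod.snd, fun P x => ?_⟩
    simp only [Finset.mem_image, Finset.mem_filter, and_assoc]
  obtain ⟨b, hbL, hbG, hbU, h1, h2, h3⟩ := hβ
    (S (fun x => x < a)) (S (fun x => a < x)) (S (fun x => ¬ x < a ∧ ¬ a < x))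
    (by
      intro x hx hy
      obtain ⟨p, hp, hpa, rfl⟩ := (key (fun x => x < a) _).1 hx
      obtain ⟨q, hq, hqa, e⟩ := (key (fun x => a < x) _).1 hy
      rw [heq q hq p hp e] at hqa
      exact lt_asymm hpa hqa)
    (by
      intro x hx hy
      obtain ⟨p, hp, hpa, rfl⟩ := (key (fun x => x < a) _).1 hx
      obtain ⟨q, hq, hqa, e⟩ := (key (fun x => ¬ x < a ∧ ¬ a < x) _).1 hy
      rw [heq q hq p hp e] at hqa
      exact hqa.1 hpa)
    (by
      intro x hx hy
      obtain ⟨p, hp, hpa, rfl⟩ := (key (fun x => a < x) _).1 hx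
      obtain ⟨q, hq, hqa, e⟩ := (key (fun x => ¬ x < a ∧ ¬ a < x) _).1 hy
      rw [heq q hq p hp e] at hqa
      exact hqa.2 hpa)
    (by
      intro x hx y hy
      obtain ⟨p, hp, hpa, rfl⟩ := (key (fun x => x < a) _).1 hx
      obtain ⟨q, hq, hqa, rfl⟩ := (key (fun x => a < x) _).1 hy
      exact (hlt p hp q hq).1 (hpa.trans hqa))
    (by
      intro x hx y hy hxy
      obtain ⟨p, hp, hpa, rfl⟩ := (key (fun x => ¬ x < a ∧ ¬ a < x) _).1 hx
      obtain ⟨q, hq, hqa, rfl⟩ := (key (fun x => x < a) _).1 hy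
      exact hpa.1 (((hlt p hp q hq).2 hxy).trans hqa))
    (by
      intro x hx y hy hxy
      obtain ⟨p, hp, hpa, rfl⟩ := (key (fun x => ¬ x < a ∧ ¬ a < x) _).1 hx
      obtain ⟨q, hq, hqa, rfl⟩ := (key (fun x => a < x) _).1 hy
      exact hpa.2 (hqa.trans ((hlt q hq p hp).2 hxy)))
  refine ⟨b, fun p hp => ?_⟩
  have hpne := hne p hp
  by_cases c1 : p.1 < a
  · have := h1 p.2 ((key (fun x => x < a) _).2 ⟨p, hp, c1, rfl⟩)
    exact ⟨iff_of_true c1.le this.le, iff_of_false c1.not_ge this.not_ge⟩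
  by_cases c2 : a < p.1
  · have := h2 p.2 ((key (fun x => a < x) _).2 ⟨p, hp, c2, rfl⟩)
    exact ⟨iff_of_false c2.not_ge this.not_ge, iff_of_true c2.le this.le⟩
  have hm := (key (fun x => ¬ x < a ∧ ¬ a < x) _).2 ⟨p, hp, ⟨c1, c2⟩, rfl⟩
  have h4 := h3 p.2 hm
  have h5 : p.2 ≠ b := fun e => hbU (e ▸ hm)
  exact ⟨iff_of_false (fun h => c1 (lt_of_le_of_ne h hpne))
      (fun h => h4.2 (lt_of_le_of_ne h h5)),
    iff_of_false (fun h => c2 (lt_of_le_of_ne h hpne.symm))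
      (fun h => h4.1 (lt_of_le_of_ne h h5.symm))⟩

/-- Finite partial isomorphisms between posets. -/
abbrev FinPartIso (α β : Type*) [PartialOrder α] [PartialOrder β] : Type _ :=
  { f : Finset (α × β) // ∀ p ∈ f, ∀ q ∈ f, p.1 ≤ q.1 ↔ p.2 ≤ q.2 }

open Classical in
/-- Adding a compatible pair to a finite partial isomorphism. -/
theorem FinPartIso.extend {α β : Type*} [PartialOrder α] [PartialOrder β]
    (f : FinPartIso α β) (a : α) (b : β)
    (h : ∀ p ∈ f.1, (p.1 ≤ a ↔ p.2 ≤ b) ∧ (a ≤ p.1 ↔ b ≤ p.2)) :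
    ∃ g : FinPartIso α β, (a, b) ∈ g.1 ∧ f ≤ g := by
  refine ⟨⟨insert (a, b) f.1, fun p hp q hq => ?_⟩, Finset.mem_insert_self _ _,
    Finset.subset_insert _ _⟩
  rw [Finset.mem_insert] at hp hq
  rcases hp with (rfl | pf) <;> rcases hq with (rfl | qf)
  · simp
  · exact (h _ qf).2
  · exact (h _ pf).1
  · exact f.2 _ pf _ qf

open Classical in
/-- Back and forth. -/
theorem RandomExt.nonempty_orderIso {α β : Type*} [PartialOrder α] [PartialOrder β]
    [Countable α] [Countable β] (hα : RandomExt α) (hβ : RandomExt β) :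
    Nonempty (α ≃o β) := by
  cases nonempty_encodable α
  cases nonempty_encodable β
  let cof : α ⊕ β → Order.Cofinal (FinPartIso α β) := fun s => Sum.casesOn s
    (fun a => ⟨{f | ∃ b, (a, b) ∈ f.1}, fun f => by
      obtain ⟨b, hb⟩ := hβ.across f.1 f.2 a
      obtain ⟨g, hg, hfg⟩ := f.extend a b hb
      exact ⟨g, ⟨b, hg⟩, hfg⟩⟩)
    (fun b => ⟨{f | ∃ a, (a, b) ∈ f.1}, fun f => by
      obtain ⟨a, ha⟩ := hα.across (f.1.image Prod.swap) (by
        intro p hp q hq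
        obtain ⟨p, hp', rfl⟩ := Finset.mem_image.1 hp
        obtain ⟨q, hq', rfl⟩ := Finset.mem_image.1 hq
        exact (f.2 p hp' q hq').symm) b
      obtain ⟨g, hg, hfg⟩ := f.extend a b (fun p hp => by
        have := ha p.swap (Finset.mem_image_of_mem _ hp)
        exact ⟨this.1.symm, this.2.symm⟩)
      exact ⟨g, ⟨a, hg⟩, hfg⟩⟩)
  let I : Order.Ideal (FinPartIso α β) :=
    Order.idealOfCofinals ⟨∅, fun _ h => (Finset.notMem_empty _ h).elim⟩ cof
  have hF : ∀ a, ∃ b, ∃ f ∈ I, (a, b) ∈ f.1 := fun a => by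
    obtain ⟨f, ⟨b, hb⟩, hf⟩ := Order.cofinal_meets_idealOfCofinals _ cof (Sum.inl a)
    exact ⟨b, f, hf, hb⟩
  have hG : ∀ b, ∃ a, ∃ f ∈ I, (a, b) ∈ f.1 := fun b => by
    obtain ⟨f, ⟨a, ha⟩, hf⟩ := Order.cofinal_meets_idealOfCofinals _ cof (Sum.inr b)
    exact ⟨a, f, hf, ha⟩
  have hle : ∀ a b a' b', (∃ f ∈ I, (a, b) ∈ f.1) → (∃ f ∈ I, (a', b') ∈ f.1) →
      (a ≤ a' ↔ b ≤ b') := by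
    rintro a b a' b' ⟨f, hf, h⟩ ⟨g, hg, h'⟩
    obtain ⟨m, _, fm, gm⟩ := I.directed _ hf _ hg
    exact m.2 (a, b) (fm h) (a', b') (gm h')
  choose F hF using hF
  choose G hG using hG
  refine ⟨⟨⟨F, G, fun a => ?_, fun b => ?_⟩, fun {a a'} => ?_⟩⟩
  · exact le_antisymm ((hle _ _ _ _ (hG (F a)) (hF a)).2 le_rfl)
      ((hle _ _ _ _ (hF a) (hG (F a))).2 le_rfl)
  · exact le_antisymm ((hle _ _ _ _ (hF (G b)) (hG b)).1 le_rfl)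
      ((hle _ _ _ _ (hG b) (hF (G b))).1 le_rfl)
  · exact (hle _ _ _ _ (hF a) (hF a')).symm

theorem RandomExt.infinite {α : Type*} [PartialOrder α] (h : RandomExt α) : Infinite α := by
  refine ⟨fun hfin => ?_⟩
  cases nonempty_fintype α
  obtain ⟨p, -, -, hp, -⟩ := h ∅ ∅ Finset.univ (by simp) (by simp) (by simp) (by simp)
    (by simp) (by simp)
  exact hp (Finset.mem_univ _)

open Classical in
theorem RandomExt.slice {D : Type*} [PartialOrder D] (hD : RandomExt D) (a b : D) (hab : a < b) :
    RandomExt ({x : D | x < b ∧ ¬ x ≤ a} : Set D) := by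
  intro L G U hLG hLU hGU h1 h2 h3
  have mem : ∀ (S : Finset ({x : D | x < b ∧ ¬ x ≤ a} : Set D)) (x : D),
      x ∈ S.image Subtype.val ↔ ∃ y ∈ S, y.1 = x := fun S x => Finset.mem_image
  have disj : ∀ S T : Finset ({x : D | x < b ∧ ¬ x ≤ a} : Set D), (∀ x ∈ S, x ∉ T) →
      ∀ x ∈ S.image Subtype.val, x ∉ T.image Subtype.val := by
    intro S T h x hx hy
    obtain ⟨y, hy', rfl⟩ := (mem _ _).1 hx
    obtain ⟨z, hz, e⟩ := (mem _ _).1 hy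
    exact h y hy' (Subtype.ext e ▸ hz)
  have hb : ∀ S : Finset ({x : D | x < b ∧ ¬ x ≤ a} : Set D),
      ∀ x ∈ S.image Subtype.val, x < b ∧ ¬ x ≤ a := by
    intro S x hx
    obtain ⟨y, hy, rfl⟩ := (mem _ _).1 hx
    exact y.2
  -- it suffices to find a suitable point of `D`
  suffices H : ∃ p : D, p < b ∧ ¬ p ≤ a ∧ p ∉ U.image Subtype.val ∧
      (∀ l ∈ L.image Subtype.val, l < p) ∧ (∀ g ∈ G.image Subtype.val, p < g) ∧
      (∀ u ∈ U.image Subtype.val, ¬ p < u ∧ ¬ u < p) by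
    obtain ⟨p, pb, pa, pU, hl, hg, hu⟩ := H
    have hl' : ∀ l ∈ L, l < (⟨p, pb, pa⟩ : ({x : D | x < b ∧ ¬ x ≤ a} : Set D)) :=
      fun l h => hl _ (Finset.mem_image_of_mem _ h)
    have hg' : ∀ g ∈ G, (⟨p, pb, pa⟩ : ({x : D | x < b ∧ ¬ x ≤ a} : Set D)) < g :=
      fun l h => hg _ (Finset.mem_image_of_mem _ h)
    exact ⟨⟨p, pb, pa⟩, fun h => lt_irrefl _ (hl' _ h), fun h => lt_irrefl _ (hg' _ h),
      fun h => pU (Finset.mem_image_of_mem _ h), hl', hg',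
      fun u h => hu _ (Finset.mem_image_of_mem _ h)⟩
  have h1' : ∀ l ∈ L.image Subtype.val, ∀ g ∈ G.image Subtype.val, l < g := by
    intro x hx y hy
    obtain ⟨x, hx', rfl⟩ := (mem _ _).1 hx
    obtain ⟨y, hy', rfl⟩ := (mem _ _).1 hy
    exact h1 _ hx' _ hy'
  have h2' : ∀ u ∈ U.image Subtype.val, ∀ l ∈ L.image Subtype.val, ¬ u < l := by
    intro x hx y hy
    obtain ⟨x, hx', rfl⟩ := (mem _ _).1 hx
    obtain ⟨y, hy', rfl⟩ := (mem _ _).1 hy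
    exact h2 _ hx' _ hy'
  have h3' : ∀ u ∈ U.image Subtype.val, ∀ g ∈ G.image Subtype.val, ¬ g < u := by
    intro x hx y hy
    obtain ⟨x, hx', rfl⟩ := (mem _ _).1 hx
    obtain ⟨y, hy', rfl⟩ := (mem _ _).1 hy
    exact h3 _ hx' _ hy'
  have dLG := disj _ _ hLG
  have dLU := disj _ _ hLU
  have dGU := disj _ _ hGU
  have bL := hb L
  have bG := hb G
  have bU := hb U
  clear h1 h2 h3 hLG hLU hGU disj mem hb
  generalize L.image Subtype.val = L' at *
  generalize G.image Subtype.val = G' at *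
  generalize U.image Subtype.val = U' at *
  rcases L'.eq_empty_or_nonempty with rfl | ⟨l, hl⟩
  · obtain ⟨p, _, _, pU, _, pg, pu⟩ := hD ∅ (insert b G') (insert a U') (by simp) (by simp)
      (by
        intro x hx hy
        rw [Finset.mem_insert] at hx hy
        rcases hx with rfl | hx <;> rcases hy with rfl | hy
        · exact lt_irrefl _ hab
        · exact lt_irrefl _ (bU _ hy).1
        · exact (bG _ hx).2 le_rfl
        · exact dGU _ hx hy)
      (by simp) (by simp)
      (by
        intro x hx y hy hlt
        rw [Finset.mem_insert] at hx hy
        rcases hx with rfl | hx <;> rcases hy with rfl | hy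
        · exact lt_asymm hab hlt
        · exact (bG _ hy).2 hlt.le
        · exact lt_asymm (bU _ hx).1 hlt
        · exact h3' _ hx _ hy hlt)
    refine ⟨p, pg b (Finset.mem_insert_self _ _), fun hpa => ?_,
      fun h => pU (Finset.mem_insert_of_mem h), by simp,
      fun g hg => pg g (Finset.mem_insert_of_mem hg),
      fun u hu => pu u (Finset.mem_insert_of_mem hu)⟩
    rcases hpa.eq_or_lt with rfl | hlt
    · exact pU (Finset.mem_insert_self _ _)
    · exact (pu a (Finset.mem_insert_self _ _)).1 hlt
  · obtain ⟨p, _, _, pU, pl, pg, pu⟩ := hD L' (insert b G') U'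
      (by
        intro x hx hy
        rw [Finset.mem_insert] at hy
        rcases hy with rfl | hy
        · exact lt_irrefl _ (bL _ hx).1
        · exact dLG _ hx hy)
      dLU
      (by
        intro x hx hy
        rw [Finset.mem_insert] at hx
        rcases hx with rfl | hx
        · exact lt_irrefl _ (bU _ hy).1
        · exact dGU _ hx hy)
      (by
        intro x hx y hy
        rw [Finset.mem_insert] at hy
        rcases hy with rfl | hy
        · exact (bL _ hx).1
        · exact h1' _ hx _ hy)
      h2'
      (by
        intro x hx y hy hlt
        rw [Finset.mem_insert] at hy
        rcases hy with rfl | hy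
        · exact lt_asymm (bU _ hx).1 hlt
        · exact h3' _ hx _ hy hlt)
    exact ⟨p, pg b (Finset.mem_insert_self _ _), fun hpa => (bL l hl).2 ((pl l hl).le.trans hpa),
      pU, pl, fun g hg => pg g (Finset.mem_insert_of_mem hg), pu⟩

theorem random_poset_slice_is_random (D : Type) [PartialOrder D]
    [Countable D] [Infinite D] (hD : RandomExt D) (a b : D) (hab : a < b) :
    Infinite ({x : D | x < b ∧ ¬ x ≤ a} : Set D) ∧
    RandomExt ({x : D | x < b ∧ ¬ x ≤ a} : Set D) ∧
    Nonempty (({x : D | x < b ∧ ¬ x ≤ a} : Set D) ≃o D) :=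
  ⟨(hD.slice a b hab).infinite, hD.slice a b hab,
    (hD.slice a b hab).nonempty_orderIso hD⟩
end

section
/- Let ⟨D,<⟩ be a countable random poset and let C ⊆ D be a maximal chain (a chain not properly contained in any other chain of D). Then C has no greatest element and no least element. -/
theorem random_poset_max_chain_unbounded (D : Type) [PartialOrder D]
    [Countable D] [Infinite D] (hD : RandomExt D) (C : Set D)
    (hC : IsMaxChain (· ≤ ·) C) :
    (¬ ∃ m ∈ C, ∀ x ∈ C, x ≤ m) ∧ (¬ ∃ m ∈ C, ∀ x ∈ C, m ≤ x) := by
  constructor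
  · rintro ⟨m, hm, h⟩
    obtain ⟨p, -, -, -, hl, -, -⟩ := hD {m} ∅ ∅ (by simp) (by simp) (by simp) (by simp) (by simp)
      (by simp)
    have hp : m < p := hl m (by simp)
    have hch : IsChain (· ≤ ·) (insert p C) :=
      hC.1.insert fun b hb _ => Or.inr ((h b hb).trans hp.le)
    have hpC : p ∈ C := by
      rw [hC.2 hch (Set.subset_insert p C)]
      exact Set.mem_insert p C
    exact absurd (h p hpC) (not_le_of_gt hp)
  · rintro ⟨m, hm, h⟩
    obtain ⟨p, -, -, -, -, hg, -⟩ := hD ∅ {m} ∅ (by simp) (by simp) (by simp) (by simp) (by simp)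
      (by simp)
    have hp : p < m := hg m (by simp)
    have hch : IsChain (· ≤ ·) (insert p C) :=
      hC.1.insert fun b hb _ => Or.inl (hp.le.trans (h b hb))
    have hpC : p ∈ C := by
      rw [hC.2 hch (Set.subset_insert p C)]
      exact Set.mem_insert p C
    exact absurd (h p hpC) (not_le_of_gt hp)
end

section
/- Let ⟨X,<⟩ be a countably infinite ultrahomogeneous partial order, i.e., every order-isomorphism between finite subsets of X extends to an order-automorphism of X. Then the partial order ⟨ℙ(X), ⊆⟩ of copies of X contains a maximal antichain of cardinality 2^ℵ₀. -/
/-- A partial order is ultrahomogeneous if every order-isomorphism between finite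
subsets extends to an order-automorphism. -/
def UltrahomogeneousOrder (X : Type*) [PartialOrder X] : Prop :=
  ∀ (F G : Set X), F.Finite → G.Finite → ∀ φ : F ≃o G,
    ∃ g : X ≃o X, ∀ x : F, g x = (φ x : X)

namespace UHPoset

variable {X : Type} [PartialOrder X]

/-- Orbit of `x` under the pointwise stabilizer of `F`. -/
def orb (F : Set X) (x : X) : Set X :=
  {y | ∃ g : X ≃o X, (∀ a ∈ F, g a = a) ∧ g x = y}

/-- Algebraic closure. -/
def cl (F : Set X) : Set X := {x | (orb F x).Finite}

theorem subset_cl (F : Set X) : F ⊆ cl F := by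
  intro x hx
  refine (Set.finite_singleton x).subset ?_
  rintro y ⟨g, hg, rfl⟩
  exact hg x hx

theorem cl_mono {F F' : Set X} (h : F ⊆ F') : cl F ⊆ cl F' := by
  intro x hx
  refine Set.Finite.subset hx ?_
  rintro y ⟨g, hg, rfl⟩
  exact ⟨g, fun a ha => hg a (h ha), rfl⟩

theorem extend (hX : UltrahomogeneousOrder X) (F : Set X) (hF : F.Finite) (p : X → X)
    (hp : ∀ a ∈ F, ∀ b ∈ F, p a ≤ p b ↔ a ≤ b) :
    ∃ g : X ≃o X, ∀ a ∈ F, g a = p a := by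
  let e : F ↪o X := OrderEmbedding.ofMapLEIff (fun a => p a)
    (fun a b => hp a a.2 b b.2)
  have : Finite F := hF
  obtain ⟨g, hg⟩ := hX F (Set.range e) hF (Set.finite_range e) e.orderIso
  refine ⟨g, fun a ha => ?_⟩
  rw [hg ⟨a, ha⟩]
  rfl

theorem same_type (hX : UltrahomogeneousOrder X) (F : Set X) (hF : F.Finite) (x y : X)
    (h : ∀ a ∈ F, (x ≤ a ↔ y ≤ a) ∧ (a ≤ x ↔ a ≤ y)) : y ∈ orb F x := by
  classical
  by_cases hx : x ∈ F
  · have := h x hx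
    have hxy : x = y := le_antisymm (this.2.1 le_rfl) (this.1.1 le_rfl)
    exact ⟨OrderIso.refl X, fun _ _ => rfl, hxy⟩
  · obtain ⟨g, hg⟩ := extend hX (insert x F) (hF.insert x) (fun z => if z = x then y else z) (by
      intro a ha b hb
      by_cases hax : a = x <;> by_cases hbx : b = x
      · simp [hax, hbx]
      · have := h b (by simpa [hbx] using hb)
        simp [hax, hbx, this.1]
      · have := h a (by simpa [hax] using ha)
        simp [hax, hbx, this.2]
      · simp [hax, hbx])
    refine ⟨g, fun a ha => ?_, ?_⟩
    · rw [hg a (Set.mem_insert_of_mem _ ha), if_neg]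
      rintro rfl
      exact hx ha
    · rw [hg x (Set.mem_insert _ _), if_pos rfl]

theorem cl_finite (hX : UltrahomogeneousOrder X) (F : Set X) (hF : F.Finite) :
    (cl F).Finite := by
  have : Finite F := hF
  let t : X → (F → Prop × Prop) := fun x a => (x ≤ a, (a : X) ≤ x)
  have : cl F ⊆ ⋃ r : F → Prop × Prop, {x | x ∈ cl F ∧ t x = r} := by
    intro x hx
    exact Set.mem_iUnion.2 ⟨t x, hx, rfl⟩
  refine Set.Finite.subset (Set.finite_iUnion fun r => ?_) this
  rcases Set.eq_empty_or_nonempty {x | x ∈ cl F ∧ t x = r} with h | ⟨x, hx, hxr⟩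
  · rw [h]; exact Set.finite_empty
  · refine Set.Finite.subset hx ?_
    rintro y ⟨-, hy⟩
    refine same_type hX F hF x y fun a ha => ?_
    have := congrFun (hxr.trans hy.symm) ⟨a, ha⟩
    simp only [t, Prod.mk.injEq, eq_iff_iff] at this
    exact this

theorem orb_cl_sub {F : Set X} {x : X} (hx : x ∈ cl F) (g : X ≃o X) (hg : ∀ a ∈ F, g a = a) :
    g x ∈ cl F := by
  refine Set.Finite.subset hx ?_
  rintro y ⟨h, hh, rfl⟩
  exact ⟨g.trans h, fun a ha => by simp [hg a ha, hh a ha], rfl⟩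

theorem cl_idem (hX : UltrahomogeneousOrder X) (F : Set X) (hF : F.Finite) :
    cl (cl F) ⊆ cl F := by
  intro x hx
  have : Finite (cl F) := cl_finite hX F hF
  have : orb F x ⊆ ⋃ r : cl F → cl F,
      {y | ∃ g : X ≃o X, (∀ a : cl F, g a = r a) ∧ g x = y} := by
    rintro y ⟨g, hg, rfl⟩
    exact Set.mem_iUnion.2 ⟨fun a => ⟨g a, orb_cl_sub a.2 g hg⟩, g, fun a => rfl, rfl⟩
  refine Set.Finite.subset (Set.finite_iUnion fun r => ?_) this
  by_cases h : ∃ g : X ≃o X, ∀ a : cl F, g a = r a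
  · obtain ⟨g, hg⟩ := h
    refine Set.Finite.subset (Set.Finite.image g hx) ?_
    rintro y ⟨g', hg', rfl⟩
    refine ⟨g.symm (g' x), ⟨g'.trans g.symm, fun a ha => ?_, rfl⟩, by simp⟩
    have h1 := hg ⟨a, ha⟩
    have h2 := hg' ⟨a, ha⟩
    simp only at h1 h2
    simp [h2, ← h1]
  · convert Set.finite_empty (α := X)
    ext y
    simp only [Set.mem_ofPred_eq, Set.mem_empty_iff_false, iff_false]
    rintro ⟨g, hg, -⟩
    exact h ⟨g, hg⟩

open scoped Pointwise in
/-- Separation lemma of P. M. Neumann. -/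
theorem neumann (F : Set X) (A B : Set X) (hA : A.Finite) (hB : B.Finite)
    (hAF : ∀ a ∈ A, a ∉ cl F) :
    ∃ g : X ≃o X, (∀ a ∈ F, g a = a) ∧ ∀ a ∈ A, g a ∉ B := by
  classical
  by_contra hcon
  push Not at hcon
  let S : Subgroup (X ≃o X) :=
    { carrier := {g | ∀ a ∈ F, g a = a}
      mul_mem' := by
        intro g h hg hh a ha
        change g (h a) = a
        rw [hh a ha, hg a ha]
      one_mem' := fun a _ => rfl
      inv_mem' := by
        intro g hg a ha
        change g.symm a = a
        rw [OrderIso.symm_apply_eq]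
        exact (hg a ha).symm }
  let T : X → Subgroup S := fun a =>
    { carrier := {g | (g : X ≃o X) a = a}
      mul_mem' := by
        intro g h hg hh
        change (g : X ≃o X) ((h : X ≃o X) a) = a
        rw [Set.mem_ofPred_eq] at hg hh
        rw [hh, hg]
      one_mem' := rfl
      inv_mem' := by
        intro g hg
        change (g : X ≃o X).symm a = a
        rw [OrderIso.symm_apply_eq]
        exact hg.symm }
  let c : X × X → S := fun p => if h : ∃ g : S, (g : X ≃o X) p.1 = p.2 then h.choose else 1
  have hc : ∀ p : X × X, (∃ g : S, (g : X ≃o X) p.1 = p.2) → (c p : X ≃o X) p.1 = p.2 := by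
    intro p h
    simp only [c, dif_pos h]
    exact h.choose_spec
  have hcov : ⋃ i ∈ hA.toFinset ×ˢ hB.toFinset, c i • (T i.1 : Set S) = Set.univ := by
    rw [Set.eq_univ_iff_forall]
    intro g
    obtain ⟨a, ha, hb⟩ := hcon g g.2
    simp only [Set.mem_iUnion]
    refine ⟨(a, (g : X ≃o X) a), by simp [ha, hb], ?_⟩
    rw [mem_leftCoset_iff]
    change (c (a, (g : X ≃o X) a) : X ≃o X).symm ((g : X ≃o X) a) = a
    rw [OrderIso.symm_apply_eq]
    exact (hc (a, (g : X ≃o X) a) ⟨g, rfl⟩).symm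
  obtain ⟨k, hk, hfi⟩ := Subgroup.exists_finiteIndex_of_leftCoset_cover hcov
  have hkA : k.1 ∈ A := by simpa using (Finset.mem_product.1 hk).1
  apply hAF k.1 hkA
  have : Finite (S ⧸ T k.1) := Subgroup.finite_quotient_of_finiteIndex
  let φ : S ⧸ T k.1 → X := fun q => ((Quotient.out q : S) : X ≃o X) k.1
  refine (Set.finite_range φ).subset ?_
  rintro y ⟨g, hg, rfl⟩
  let s : S := ⟨g, hg⟩
  refine ⟨(s : S ⧸ T k.1), ?_⟩
  have h1 : (Quotient.out (s : S ⧸ T k.1))⁻¹ * s ∈ T k.1 := by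
    rw [← QuotientGroup.eq]
    exact Quotient.out_eq _
  have h2 : ((Quotient.out (s : S ⧸ T k.1) : S) : X ≃o X).symm (g k.1) = k.1 := h1
  rw [OrderIso.symm_apply_eq] at h2
  exact h2.symm

/-- The tree of automorphisms. -/
noncomputable def tree (F : ℕ → Set X) (H : ℕ → ℕ → Set X → (X ≃o X)) : ℕ → (X ≃o X)
  | 0 => OrderIso.refl X
  | k + 1 => (H (k / 2) (k + 1) ((tree F H (k / 2)) ⁻¹'
      ⋃ j : Fin (k + 1), tree F H j.1 '' F j.1)).trans (tree F H (k / 2))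
termination_by k => k
decreasing_by all_goals omega

/-- Branches of the binary tree. -/
def br (f : ℕ → Bool) : ℕ → ℕ
  | 0 => 0
  | n + 1 => 2 * br f n + (f n).toNat + 1

theorem br_half (f : ℕ → Bool) (n : ℕ) : (2 * br f n + (f n).toNat) / 2 = br f n := by
  have := Bool.toNat_lt (f n)
  omega

theorem br_inj (f g : ℕ → Bool) (n m : ℕ) (h : br f n = br g m) :
    n = m ∧ ∀ i < n, f i = g i := by
  induction n generalizing m with
  | zero =>
    cases m with
    | zero => simp
    | succ m => simp [br] at h
  | succ n ih =>
    cases m with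
    | zero => simp [br] at h
    | succ m =>
      simp only [br] at h
      have h1 := Bool.toNat_lt (f n)
      have h2 := Bool.toNat_lt (g m)
      obtain ⟨rfl, h3⟩ := ih m (by omega)
      refine ⟨rfl, fun i hi => ?_⟩
      rcases Nat.lt_succ_iff_lt_or_eq.1 hi with h4 | rfl
      · exact h3 i h4
      · have h5 : (f i).toNat = (g i).toNat := by omega
        revert h5
        cases f i <;> cases g i <;> simp

theorem br_ge (f : ℕ → Bool) (n : ℕ) : n ≤ br f n := by
  induction n with
  | zero => simp
  | succ n ih => simp only [br]; omega

theorem exists_family [Countable X] [Infinite X] (hX : UltrahomogeneousOrder X) :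
    ∃ A : (ℕ → Bool) → Set X, (∀ f, IsCopyO (A f)) ∧ ∀ f g, f ≠ g → (A f ∩ A g).Finite := by
  classical
  obtain ⟨en, hen⟩ := exists_surjective_nat X
  let F : ℕ → Set X := fun n => cl (en '' Set.Iic n)
  have hI : ∀ n, (en '' Set.Iic n).Finite := fun n => (Set.finite_Iic n).image _
  have hFfin : ∀ n, (F n).Finite := fun n => cl_finite hX _ (hI n)
  have hFmono : Monotone F := fun m n h => cl_mono (Set.image_mono (Set.Iic_subset_Iic.2 h))
  have hFcl : ∀ n, cl (F n) ⊆ F n := fun n => cl_idem hX _ (hI n)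
  have hFmem : ∀ n, en n ∈ F n := fun n => subset_cl _ ⟨n, Set.mem_Iic.2 le_rfl, rfl⟩
  have step : ∀ (p k : ℕ) (B : Set X), ∃ g : X ≃o X, B.Finite →
      (∀ a ∈ F p, g a = a) ∧ ∀ a ∈ F k, a ∉ F p → g a ∉ B := by
    intro p k B
    by_cases hB : B.Finite
    · obtain ⟨g, h1, h2⟩ := neumann (F p) (F k \ F p) B ((hFfin k).sdiff) hB
        (fun a ha h => ha.2 (hFcl p h))
      exact ⟨g, fun _ => ⟨h1, fun a h3 h4 => h2 a ⟨h3, h4⟩⟩⟩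
    · exact ⟨OrderIso.refl X, fun h => absurd h hB⟩
  choose H hH using step
  let t := tree F H
  have ht : ∀ k, (∀ a ∈ F (k / 2), t (k + 1) a = t (k / 2) a) ∧
      ∀ a ∈ F (k + 1), a ∉ F (k / 2) → ∀ j ≤ k, ∀ b ∈ F j, t (k + 1) a ≠ t j b := by
    intro k
    have hfin : ((t (k / 2)) ⁻¹' ⋃ j : Fin (k + 1), t j.1 '' F j.1).Finite :=
      Set.Finite.preimage (t (k / 2)).injective.injOn
        (Set.finite_iUnion fun j => (hFfin j.1).image _)
    obtain ⟨h1, h2⟩ := hH (k / 2) (k + 1) _ hfin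
    have heq : t (k + 1) = (H (k / 2) (k + 1) ((t (k / 2)) ⁻¹'
      ⋃ j : Fin (k + 1), t j.1 '' F j.1)).trans (t (k / 2)) := by
      simp only [t]
      rw [tree]
    constructor
    · intro a ha
      rw [heq, OrderIso.trans_apply, h1 a ha]
    · intro a ha ha' j hj b hb hab
      apply h2 a ha ha'
      rw [Set.mem_preimage, ← OrderIso.trans_apply, ← heq, hab]
      exact Set.mem_iUnion.2 ⟨⟨j, by omega⟩, b, hb, rfl⟩
  -- stabilization
  have hstab : ∀ f n m, n ≤ m → F (br f n) ⊆ F (br f m) ∧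
      ∀ a ∈ F (br f n), t (br f m) a = t (br f n) a := by
    intro f n m hnm
    induction m, hnm using Nat.le_induction with
    | base => exact ⟨subset_rfl, fun _ _ => rfl⟩
    | succ m hm ih =>
      have h1 := (ht (2 * br f m + (f m).toNat)).1
      rw [br_half] at h1
      refine ⟨ih.1.trans (hFmono (by simp only [br]; omega)), fun a ha => ?_⟩
      rw [← ih.2 a ha]
      exact h1 a (ih.1 ha)
  have hex : ∀ f x, ∃ n, x ∈ F (br f n) := by
    intro f x
    obtain ⟨n, rfl⟩ := hen x
    exact ⟨n, hFmono (br_ge f n) (hFmem n)⟩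
  let N : (ℕ → Bool) → X → ℕ := fun f x => Nat.find (hex f x)
  have hN : ∀ f x, x ∈ F (br f (N f x)) := fun f x => Nat.find_spec (hex f x)
  have hNmin : ∀ f x n, n < N f x → x ∉ F (br f n) := fun f x n h => Nat.find_min (hex f x) h
  let e : (ℕ → Bool) → X → X := fun f x => t (br f (N f x)) x
  have he : ∀ f x n, N f x ≤ n → e f x = t (br f n) x := fun f x n h =>
    ((hstab f _ _ h).2 x (hN f x)).symm
  have hele : ∀ f x y, e f x ≤ e f y ↔ x ≤ y := by
    intro f x y
    rw [he f x (max (N f x) (N f y)) (le_max_left _ _),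
      he f y (max (N f x) (N f y)) (le_max_right _ _)]
    exact OrderIso.le_iff_le _
  refine ⟨fun f => Set.range (e f), fun f => ?_, fun f g hfg => ?_⟩
  · exact ⟨((OrderEmbedding.ofMapLEIff (e f) (hele f)).orderIso).symm⟩
  · obtain ⟨n, hn⟩ := Function.ne_iff.1 hfg
    -- key separation
    have key : ∀ (f g : ℕ → Bool) x y, e f x = e g y → n < N f x → f n ≠ g n →
        br f (N f x) ≤ br g (N g y) → br f (N f x) < br g (N g y) := by
      intro f g x y _ h1 h2 h3
      refine lt_of_le_of_ne h3 fun h4 => h2 ((br_inj f g _ _ h4).2 n h1)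
    have key2 : ∀ (f g : ℕ → Bool) x y, e f x = e g y → n < N f x →
        br g (N g y) < br f (N f x) → False := by
      intro f g x y hxy h1 h3
      obtain ⟨m, hm⟩ : ∃ m, N f x = m + 1 := ⟨N f x - 1, by omega⟩
      have h4 := (ht (2 * br f m + (f m).toNat)).2
      rw [br_half] at h4
      have h5 := hN f x
      have hxy' : t (br f (N f x)) x = t (br g (N g y)) y := hxy
      rw [hm] at h3 h5 hxy'
      simp only [br] at h3
      exact h4 x h5 (hNmin f x m (by omega)) _ (by omega) y (hN g y) hxy'
    refine Set.Finite.subset (((hFfin (br f n)).image (t (br f n))).union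
      ((hFfin (br g n)).image (t (br g n)))) ?_
    rintro z ⟨⟨x, rfl⟩, ⟨y, hy⟩⟩
    by_cases h1 : N f x ≤ n
    · left
      exact ⟨x, (hstab f _ _ h1).1 (hN f x), (he f x n h1).symm⟩
    by_cases h2 : N g y ≤ n
    · right
      refine ⟨y, (hstab g _ _ h2).1 (hN g y), ?_⟩
      rw [← hy]
      exact (he g y n h2).symm
    exfalso
    push Not at h1 h2
    rcases le_or_gt (br f (N f x)) (br g (N g y)) with h3 | h3
    · exact key2 g f y x hy h2 (key f g x y hy.symm h1 hn h3)
    · exact key2 f g x y hy.symm h1 h3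

end UHPoset

theorem uh_poset_continuum_max_antichain (X : Type) [PartialOrder X]
    [Countable X] [Infinite X] (hX : UltrahomogeneousOrder X) :
    ∃ 𝒜 : Set (Set X), Cardinal.mk 𝒜 = Cardinal.continuum ∧ IsMaxAntichainO 𝒜 := by
  classical
  obtain ⟨A, hA, hAd⟩ := UHPoset.exists_family hX
  have hinf : ∀ C : Set X, IsCopyO C → C.Infinite := by
    rintro C ⟨e⟩
    exact Set.infinite_coe_iff.1 (Infinite.of_injective e.symm e.symm.injective)
  have hAinj : Function.Injective A := by
    intro f g h
    by_contra hne
    have := hAd f g hne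
    rw [← h, Set.inter_self] at this
    exact hinf _ (hA f) this
  let P : Set (Set (Set X)) := {𝒜 | (∀ A ∈ 𝒜, IsCopyO A) ∧
    (∀ A ∈ 𝒜, ∀ B ∈ 𝒜, A ≠ B → ¬ CompatO A B)}
  have h0 : Set.range A ∈ P := by
    refine ⟨?_, ?_⟩
    · rintro _ ⟨f, rfl⟩
      exact hA f
    · rintro _ ⟨f, rfl⟩ _ ⟨g, rfl⟩ hne ⟨C, hC, h1, h2⟩
      exact hinf C hC ((hAd f g fun h => hne (h ▸ rfl)).subset (Set.subset_inter h1 h2))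
  obtain ⟨𝒜, hsub, hmax⟩ := zorn_subset_nonempty P (by
    intro c hc hchain _
    refine ⟨⋃₀ c, ⟨?_, ?_⟩, fun s hs => Set.subset_sUnion_of_mem hs⟩
    · rintro A ⟨s, hs, hAs⟩
      exact (hc hs).1 A hAs
    · rintro A ⟨s, hs, hAs⟩ B ⟨s', hs', hBs⟩
      rcases hchain.total hs hs' with h | h
      · exact (hc hs').2 A (h hAs) B hBs
      · exact (hc hs).2 A hAs B (h hBs)) _ h0
  refine ⟨𝒜, le_antisymm ?_ ?_, hmax.prop.1, hmax.prop.2, ?_⟩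
  · calc Cardinal.mk 𝒜 ≤ Cardinal.mk (Set X) := Cardinal.mk_set_le 𝒜
      _ = Cardinal.continuum := by
        rw [Cardinal.mk_set, Cardinal.mk_eq_aleph0, Cardinal.two_power_aleph0]
  · calc Cardinal.continuum = Cardinal.mk (ℕ → Bool) := by simp
      _ = Cardinal.mk (Set.range A) := (Cardinal.mk_range_eq A hAinj).symm
      _ ≤ Cardinal.mk 𝒜 := Cardinal.mk_le_mk_of_subset hsub
  · intro Z hZ
    by_contra hcon
    push Not at hcon
    have hsymm : ∀ B C : Set X, CompatO B C → CompatO C B :=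
      fun B C ⟨D, h1, h2, h3⟩ => ⟨D, h1, h3, h2⟩
    have hins : insert Z 𝒜 ∈ P := by
      refine ⟨?_, ?_⟩
      · rintro B (rfl | hB)
        · exact hZ
        · exact hmax.prop.1 B hB
      · rintro B (rfl | hB) C (rfl | hC) hne
        · exact absurd rfl hne
        · exact hcon C hC
        · exact fun h => hcon B hB (hsymm _ _ h)
        · exact hmax.prop.2 B hB C hC hne
    have : Z ∈ 𝒜 := hmax.le_of_ge hins (Set.subset_insert _ _) (Set.mem_insert _ _)
    exact hcon Z this ⟨Z, hZ, subset_rfl, subset_rfl⟩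
end
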